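/- arXiv:2302.11764 — 5 statements merged into one kernel-verified Lean document; each statement's English description precedes it below -/
import Mathlib

section
/- Let P ⊆ ℝ^d be a full-dimensional polytope with vertex set V and fix a nonzero x ∈ ℝ^d. Let T_x := {t ∈ ℝ^d : ⟨x, v + t⟩ ≠ 0 for all v ∈ V}. Then on each connected component of T_x, the function t ↦ vol_{d−1}((P + t) ∩ x^⊥) coincides with the restriction of a polynomial in the d real variables t₁, …, t_d of total degree at most d − 1. Equivalently, on each such component the radial function ρ_{I(P+t)}(x) = vol_{d−1}((P+t) ∩ x^⊥)/‖x‖ is, as a function of t, a polynomial of degree at most d − 1. -/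
open MeasureTheory
open scoped RealInnerProductSpace

noncomputable section

/-- The hyperplane through the origin orthogonal to `x`. -/
def perp {d : ℕ} (x : EuclideanSpace ℝ (Fin d)) : Set (EuclideanSpace ℝ (Fin d)) :=
  {y | ⟪x, y⟫ = 0}

/-- Radial function of the intersection body: `x ↦ vol_s(P ∩ x^⊥) / ‖x‖`,
where `vol_s` is the `s`-dimensional Hausdorff measure. -/
def radialFn {d : ℕ} (s : ℝ) (P : Set (EuclideanSpace ℝ (Fin d)))
    (x : EuclideanSpace ℝ (Fin d)) : ℝ :=
  (μH[s] (P ∩ perp x)).toReal / ‖x‖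

/-- The intersection body `IP = {0} ∪ {x ≠ 0 : ρ_IP(x) ≥ 1}`. -/
def ibody {d : ℕ} (s : ℝ) (P : Set (EuclideanSpace ℝ (Fin d))) :
    Set (EuclideanSpace ℝ (Fin d)) :=
  {0} ∪ {x | x ≠ 0 ∧ 1 ≤ radialFn s P x}

/-- A polytope: the convex hull of finitely many points. -/
def IsPolytope {d : ℕ} (P : Set (EuclideanSpace ℝ (Fin d))) : Prop :=
  ∃ S : Finset (EuclideanSpace ℝ (Fin d)), P = convexHull ℝ (S : Set (EuclideanSpace ℝ (Fin d)))

/-- `conv(a,b)` is an edge of `P`: a one-dimensional face (i.e. an extreme convex subset). -/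
def IsEdgeOf {d : ℕ} (P : Set (EuclideanSpace ℝ (Fin d))) (a b : EuclideanSpace ℝ (Fin d)) :
    Prop :=
  a ≠ b ∧ IsExtreme ℝ P (segment ℝ a b)

section

open Set

theorem mem_convexHull_range_iff {κ E : Type*} [Fintype κ] [AddCommGroup E] [Module ℝ E]
    (v : κ → E) (y : E) :
    y ∈ convexHull ℝ (range v) ↔ ∃ w ∈ stdSimplex ℝ κ, ∑ i, w i • v i = y := by
  classical
  have h : range v = Fintype.linearCombination ℝ v '' range fun i : κ => Pi.single i (1 : ℝ) := by
    ext z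
    simp
  rw [h, ← LinearMap.image_convexHull, convexHull_rangle_single_eq_stdSimplex]
  simp [Fintype.linearCombination_apply]

section Volume

variable {E : Type*} [NormedAddCommGroup E] [NormedSpace ℝ E] [FiniteDimensional ℝ E]
  [MeasurableSpace E] [BorelSpace E] (μ : Measure E) [μ.IsAddHaarMeasure]

theorem addHaar_affineMap_eq_zero (g : E →ᵃ[ℝ] ℝ) {z : E} (hz : g z ≠ 0) :
    μ {y | g y = 0} = 0 := by
  have h := Measure.addHaar_affineSubspace μ ((AffineSubspace.mk' (0 : ℝ) ⊥).comap g) (by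
    intro h
    have hz' : z ∈ (AffineSubspace.mk' (0 : ℝ) ⊥).comap g := by rw [h]; trivial
    exact hz (by simpa [AffineSubspace.mem_comap, AffineSubspace.mem_mk'] using hz'))
  convert h using 2
  ext y
  simp [AffineSubspace.mem_mk']

theorem addHaar_linearMap_eq_const (h : E →ₗ[ℝ] ℝ) (hh : h ≠ 0) (s : ℝ) :
    μ {y | h y = s} = 0 := by
  obtain ⟨u, hu⟩ : ∃ u, h u ≠ 0 := by
    by_contra! H
    exact hh (LinearMap.ext H)
  have hz : (h.toAffineMap - AffineMap.const ℝ E s) (((s + 1) / h u) • u) ≠ 0 := by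
    simp [div_mul_cancel₀ _ hu]
  convert addHaar_affineMap_eq_zero μ (h.toAffineMap - AffineMap.const ℝ E s) hz using 3
  simp [sub_eq_zero]

theorem addHaar_convexHull_eq_zero {S : Set E} (hS : affineSpan ℝ S ≠ ⊤) :
    μ (convexHull ℝ S) = 0 :=
  measure_mono_null (convexHull_subset_affineSpan S) (Measure.addHaar_affineSubspace μ _ hS)

omit [FiniteDimensional ℝ E] [BorelSpace E] in
theorem measure_convexHull_range_ne_top {κ : Type*} [Finite κ] (v : κ → E) (A : Set E) :
    μ (convexHull ℝ (range v) ∩ A) ≠ ⊤ :=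
  ((measure_mono inter_subset_left).trans_lt
    ((finite_range v).isCompact_convexHull ℝ).measure_lt_top).ne

variable {κ : Type*} [Fintype κ] [DecidableEq κ]

omit [FiniteDimensional ℝ E] [MeasurableSpace E] [BorelSpace E] in
theorem AffineBasis.convexHull_range_update (b : AffineBasis κ ℝ E) {i j : κ} (hij : i ≠ j)
    {θ : ℝ} (h0 : 0 < θ) (h1 : θ < 1) :
    convexHull ℝ (range (Function.update b i ((1 - θ) • b i + θ • b j))) =
      convexHull ℝ (range b) ∩ {y | (θ • b.coord i - (1 - θ) • b.coord j) y ≤ 0} := by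
  have h1' : (1 - θ) ≠ 0 := by linarith
  apply Subset.antisymm
  · refine convexHull_min ?_ ((convex_convexHull ℝ _).inter
      (Convex.affine_preimage (𝕜 := ℝ) _ (convex_Iic (0 : ℝ))))
    have hw : (1 - θ) • b i + θ • b j = AffineMap.lineMap (b i) (b j) θ := by
      rw [AffineMap.lineMap_apply_module]
    rintro _ ⟨k, rfl⟩
    by_cases hk : k = i
    · subst hk
      rw [Function.update_self]
      refine ⟨convex_convexHull ℝ (range b) (subset_convexHull ℝ _ (mem_range_self k))
        (subset_convexHull ℝ _ (mem_range_self j)) (by linarith) h0.le (by ring), ?_⟩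
      change θ • b.coord k _ - (1 - θ) • b.coord j _ ≤ 0
      rw [hw, AffineMap.apply_lineMap, AffineMap.apply_lineMap, b.coord_apply_eq, b.coord_apply_eq,
        b.coord_apply_ne hij, b.coord_apply_ne hij.symm]
      simp only [AffineMap.lineMap_apply_module, smul_eq_mul]
      apply le_of_eq; ring
    · rw [Function.update_of_ne hk]
      refine ⟨subset_convexHull ℝ _ (mem_range_self k), ?_⟩
      by_cases hkj : k = j
      · subst hkj
        simp [b.coord_apply_ne hij, h1.le]
      · simp [b.coord_apply_ne (Ne.symm hk), b.coord_apply_ne (Ne.symm hkj)]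
  · rintro y ⟨hy, hg⟩
    rw [b.convexHull_eq_nonneg_coord] at hy
    simp only [mem_ofPred_eq, AffineMap.coe_sub, AffineMap.coe_smul, Pi.sub_apply, Pi.smul_apply,
      smul_eq_mul] at hg hy
    set c := b.coord i y * θ / (1 - θ) with hc
    have hc0 : 0 ≤ c := div_nonneg (mul_nonneg (hy i) h0.le) (by linarith)
    have hcj : c ≤ b.coord j y := by
      rw [hc, div_le_iff₀ (by linarith)]
      linarith
    rw [mem_convexHull_range_iff]
    refine ⟨fun k => b.coord k y + (Pi.single i c : κ → ℝ) k - (Pi.single j c : κ → ℝ) k,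
      ⟨fun k => ?_, ?_⟩, ?_⟩
    · by_cases hk : k = j
      · subst hk
        simp [hij.symm, hcj]
      · by_cases hki : k = i
        · subst hki
          simpa [Pi.single_apply, hk] using add_nonneg (hy k) hc0
        · simpa [Pi.single_apply, hk, hki] using hy k
    · simp [Finset.sum_sub_distrib, Finset.sum_add_distrib]
    · have hcθ : (b.coord i y + c) * θ = c := by
        rw [hc]; field_simp; ring
      have hk : ∀ k, (b.coord k y + (Pi.single i c : κ → ℝ) k - (Pi.single j c : κ → ℝ) k) •
          Function.update b i ((1 - θ) • b i + θ • b j) k = b.coord k y • b k +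
            (Pi.single i (c • b j) : κ → E) k - (Pi.single j (c • b j) : κ → E) k := by
        intro k
        by_cases hk : k = i
        · subst hk
          simp only [Function.update_self, Pi.single_eq_same, Pi.single_eq_of_ne hij, sub_zero]
          calc _ = (b.coord k y + c - (b.coord k y + c) * θ) • b k
                + ((b.coord k y + c) * θ) • b j := by module
            _ = _ := by rw [hcθ, add_sub_cancel_right]
        · rw [Function.update_of_ne hk]
          by_cases hkj : k = j
          · subst hkj
            simp only [Pi.single_eq_same, Pi.single_eq_of_ne hk]
            module
          · simp [Pi.single_eq_of_ne hk, Pi.single_eq_of_ne hkj]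
      simp only [hk, Finset.sum_add_distrib, Finset.sum_sub_distrib, Finset.sum_pi_single',
        b.linear_combination_coord_eq_self]
      simp

omit [Fintype κ] in
theorem AffineBasis.addHaar_real_convexHull_update (b : AffineBasis κ ℝ E) {i j : κ} (hij : i ≠ j)
    {θ : ℝ} (h1 : θ ≤ 1) :
    μ.real (convexHull ℝ (range (Function.update b i ((1 - θ) • b i + θ • b j)))) =
      (1 - θ) * μ.real (convexHull ℝ (range b)) := by
  set T := LinearMap.transvection (b.coord i).linear (θ • (b j - b i)) with hT
  have hl : ∀ k, (b.coord i).linear (b k) - (b.coord i).linear (b j) = if k = i then 1 else 0 := by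
    intro k
    rw [← map_sub, ← vsub_eq_sub, AffineMap.linearMap_vsub, b.coord_apply_ne hij, b.coord_apply]
    simp [eq_comm]
  have hr : range (Function.update b i ((1 - θ) • b i + θ • b j)) =
      (T.toAffineMap + AffineMap.const ℝ E (b j - T (b j))) '' range b := by
    rw [← range_comp]
    congr 1
    ext k
    have : T (b k) - T (b j) = b k - b j + (if k = i then (1 : ℝ) else 0) • θ • (b j - b i) := by
      rw [← hl]
      simp only [hT, LinearMap.transvection.apply]
      module
    have h2 : (T.toAffineMap + AffineMap.const ℝ E (b j - T (b j))) (b k)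
        = b k + (if k = i then (1 : ℝ) else 0) • θ • (b j - b i) := by
      have h3 : (T.toAffineMap + AffineMap.const ℝ E (b j - T (b j))) (b k)
        = T (b k) - T (b j) + b j := by
        simp; abel
      rw [h3, this]; abel
    rw [Function.comp_apply, h2]
    by_cases hk : k = i
    · subst hk
      simp only [Function.update_self, if_true]
      module
    · simp [hk]
  have hdet : LinearMap.det T = 1 - θ := by
    rw [hT, LinearMap.transvection.det, map_smul, ← neg_sub (b i), map_neg, map_sub, hl]
    simp [sub_eq_add_neg]
  rw [hr, ← AffineMap.image_convexHull]
  have him : (T.toAffineMap + AffineMap.const ℝ E (b j - T (b j))) '' convexHull ℝ (range b) =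
      (fun y => y + (b j - T (b j))) '' (T '' convexHull ℝ (range b)) := by
    rw [image_image]
    rfl
  rw [him, image_add_right, measureReal_def, measure_preimage_add_right,
    Measure.addHaar_image_linearMap, hdet, ENNReal.toReal_mul,
    ENNReal.toReal_ofReal (abs_nonneg _), abs_of_nonneg (by linarith), measureReal_def]

theorem AffineBasis.addHaar_real_split (b : AffineBasis κ ℝ E) {i j : κ} (hij : i ≠ j)
    {θ : ℝ} (h0 : 0 < θ) (h1 : θ < 1) (A : Set E) :
    μ.real (convexHull ℝ (range b) ∩ A) =
      μ.real (convexHull ℝ (range (Function.update b i ((1 - θ) • b i + θ • b j))) ∩ A) +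
      μ.real (convexHull ℝ (range (Function.update b j ((1 - θ) • b i + θ • b j))) ∩ A) := by
  have e1 := b.convexHull_range_update hij h0 h1
  have e2 := b.convexHull_range_update hij.symm (θ := 1 - θ) (by linarith) (by linarith)
  rw [sub_sub_cancel, add_comm] at e2
  set g := θ • b.coord i - (1 - θ) • b.coord j with hg
  have hz : g (b i) ≠ 0 := by
    simp [hg, b.coord_apply_ne hij.symm, h0.ne']
  have hgm : MeasurableSet {y | g y ≤ 0} :=
    measurableSet_le g.continuous_of_finiteDimensional.measurable measurable_const
  have hne : {y | ((1 - θ) • b.coord j - θ • b.coord i) y ≤ 0} = {y | 0 ≤ g y} := by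
    ext y
    simp [hg]
  rw [e1, e2, hne, ← measureReal_inter_add_sdiff (s := convexHull ℝ (range b) ∩ A) hgm
    (measure_convexHull_range_ne_top μ b A)]
  congr 1
  · congr 1
    ext y
    simp only [mem_inter_iff]; tauto
  · apply measureReal_congr
    have h0 : ∀ᵐ y ∂μ, g y ≠ 0 := by
      rw [ae_iff]
      simpa using addHaar_affineMap_eq_zero μ g hz
    filter_upwards [h0] with y hy
    apply propext
    change (y ∈ (convexHull ℝ (range b) ∩ A) \ {y | g y ≤ 0}) ↔
      y ∈ (convexHull ℝ (range b) ∩ {y | 0 ≤ g y}) ∩ A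
    have : ¬ g y ≤ 0 ↔ 0 ≤ g y := by
      rw [not_le]
      exact ⟨le_of_lt, fun h => lt_of_le_of_ne h (Ne.symm hy)⟩
    simp only [mem_sdiff, mem_inter_iff, mem_ofPred_eq, this]
    tauto


omit [FiniteDimensional ℝ E] [MeasurableSpace E] [BorelSpace E] [DecidableEq κ] in
theorem affineIndependent_of_affineSpan_eq_top {v : κ → E} (hv : affineSpan ℝ (range v) = ⊤)
    (hκ : Fintype.card κ = Module.finrank ℝ E + 1) : AffineIndependent ℝ v := by
  rw [affineIndependent_iff_finrank_vectorSpan_eq ℝ v hκ, ← direction_affineSpan, hv,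
    AffineSubspace.direction_top, finrank_top]

omit [DecidableEq κ] in
/-- The fraction of a simplex lying below the level `s` of a linear functional is polynomial in `s`,
when the vertices in `N` have fixed heights `c i` and the other vertices have height `s`. -/
theorem exists_polynomial_addHaar_simplex (hκ : Fintype.card κ = Module.finrank ℝ E + 1)
    {h : E →ₗ[ℝ] ℝ} (hh : h ≠ 0) {J : Set ℝ} (hJ : J.Nonempty) (c : κ → ℝ)
    (hc : ∀ i, (∀ s ∈ J, c i < s) ∨ (∀ s ∈ J, s < c i)) (N : Finset κ) :
    ∃ q : Polynomial ℝ, q.natDegree ≤ N.card - 1 ∧ ∀ s ∈ J, ∀ v : κ → E,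
      (∀ i ∈ N, h (v i) = c i) → (∀ i ∉ N, h (v i) = s) →
      μ.real (convexHull ℝ (range v) ∩ {y | h y ≤ s}) =
        q.eval s * μ.real (convexHull ℝ (range v)) := by
  classical
  induction N using Finset.strongInduction with
  | H N ih =>
    by_cases hlow : ∀ i ∈ N, ∀ s ∈ J, c i < s
    · refine ⟨1, by simp, fun s hs v hN hN' => ?_⟩
      have hsub : convexHull ℝ (range v) ⊆ {y | h y ≤ s} := by
        refine convexHull_min ?_ (convex_halfSpace_le h.isLinear s)
        rintro _ ⟨i, rfl⟩
        by_cases hi : i ∈ N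
        · exact (hN i hi).trans_le (hlow i hi s hs).le
        · exact (hN' i hi).le
      rw [inter_eq_left.2 hsub, Polynomial.eval_one, one_mul]
    by_cases hupp : ∀ i ∈ N, ∀ s ∈ J, s < c i
    · refine ⟨0, by simp, fun s hs v hN hN' => ?_⟩
      have hsub : convexHull ℝ (range v) ⊆ {y | s ≤ h y} := by
        refine convexHull_min ?_ (convex_halfSpace_ge h.isLinear s)
        rintro _ ⟨i, rfl⟩
        by_cases hi : i ∈ N
        · exact (hupp i hi s hs).le.trans_eq (hN i hi).symm
        · exact (hN' i hi).ge
      rw [Polynomial.eval_zero, zero_mul, measureReal_def, measure_mono_null _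
        (addHaar_linearMap_eq_const μ h hh s), ENNReal.toReal_zero]
      exact fun y hy => le_antisymm hy.2 (hsub hy.1)
    obtain ⟨j, hjN, hj⟩ : ∃ j ∈ N, ∀ s ∈ J, s < c j := by
      by_contra! H
      refine hlow fun i hi => (hc i).resolve_right fun h' => ?_
      obtain ⟨s, hs, hs'⟩ := H i hi
      exact absurd (h' s hs) hs'.not_gt
    obtain ⟨i, hiN, hi⟩ : ∃ i ∈ N, ∀ s ∈ J, c i < s := by
      by_contra! H
      refine hupp fun i hi => (hc i).resolve_left fun h' => ?_
      obtain ⟨s, hs, hs'⟩ := H i hi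
      exact absurd (h' s hs) hs'.not_gt
    have hcij : c i < c j := hJ.elim fun s hs => (hi s hs).trans (hj s hs)
    have hij : i ≠ j := by rintro rfl; exact hcij.false
    obtain ⟨qi, hqi, hqi'⟩ := ih (N.erase i) (Finset.erase_ssubset hiN)
    obtain ⟨qj, hqj, hqj'⟩ := ih (N.erase j) (Finset.erase_ssubset hjN)
    have hcard : 2 ≤ N.card := Finset.one_lt_card.2 ⟨i, hiN, j, hjN, hij⟩
    rw [Finset.card_erase_of_mem hiN] at hqi
    rw [Finset.card_erase_of_mem hjN] at hqj
    set a := (c j - c i)⁻¹ with ha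
    have hlin : ∀ r t : ℝ, (Polynomial.C r * Polynomial.X + Polynomial.C t).natDegree ≤ 1 :=
      fun r t => Polynomial.natDegree_linear_le
    refine ⟨(Polynomial.C (-a) * Polynomial.X + Polynomial.C (1 + a * c i)) * qi +
      (Polynomial.C a * Polynomial.X + Polynomial.C (-(a * c i))) * qj, ?_, fun s hs v hN hN' => ?_⟩
    · refine (Polynomial.natDegree_add_le _ _).trans (max_le ?_ ?_)
      · refine Polynomial.natDegree_mul_le.trans ?_
        have := hlin (-a) (1 + a * c i)
        omega
      · refine Polynomial.natDegree_mul_le.trans ?_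
        have := hlin a (-(a * c i))
        omega
    by_cases hv : affineSpan ℝ (range v) = ⊤
    swap
    · have h0 := addHaar_convexHull_eq_zero μ hv
      rw [measureReal_def, measureReal_def, h0, measure_mono_null inter_subset_left h0]
      simp
    let b : AffineBasis κ ℝ E := ⟨v, affineIndependent_of_affineSpan_eq_top hv hκ, hv⟩
    have hb : ⇑b = v := rfl
    set θ := a * (s - c i) with hθ
    have hapos : 0 < a := inv_pos.2 (sub_pos.2 hcij)
    have hθ0 : 0 < θ := mul_pos hapos (sub_pos.2 (hi s hs))
    have haij : a * (c j - c i) = 1 := inv_mul_cancel₀ (sub_pos.2 hcij).ne'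
    have hθ1 : θ < 1 := by
      rw [← haij]
      exact mul_lt_mul_of_pos_left (by linarith [hj s hs]) hapos
    have hw : h ((1 - θ) • v i + θ • v j) = s := by
      rw [map_add, map_smul, map_smul, hN i hiN, hN j hjN, smul_eq_mul, smul_eq_mul]
      linear_combination (s - c i) * haij
    have key : ∀ k ∈ N, ∀ q : Polynomial ℝ, (∀ s ∈ J, ∀ v : κ → E,
        (∀ i ∈ N.erase k, h (v i) = c i) → (∀ i ∉ N.erase k, h (v i) = s) →
        μ.real (convexHull ℝ (range v) ∩ {y | h y ≤ s}) =
          q.eval s * μ.real (convexHull ℝ (range v))) →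
        μ.real (convexHull ℝ (range (Function.update v k ((1 - θ) • v i + θ • v j))) ∩
          {y | h y ≤ s}) = q.eval s *
          μ.real (convexHull ℝ (range (Function.update v k ((1 - θ) • v i + θ • v j)))) := by
      intro k hk q hq
      refine hq s hs _ (fun l hl => ?_) (fun l hl => ?_)
      · rw [Function.update_of_ne (Finset.ne_of_mem_erase hl)]
        exact hN l (Finset.mem_of_mem_erase hl)
      · by_cases hlk : l = k
        · rw [hlk, Function.update_self, hw]
        · rw [Function.update_of_ne hlk]
          exact hN' l fun hl' => hl (Finset.mem_erase.2 ⟨hlk, hl'⟩)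
    have hui := b.addHaar_real_convexHull_update μ hij hθ1.le
    have huj := b.addHaar_real_convexHull_update μ hij.symm (θ := 1 - θ) (by linarith)
    rw [sub_sub_cancel, add_comm] at huj
    have hsplit := b.addHaar_real_split μ hij hθ0 hθ1 {y | h y ≤ s}
    rw [hb] at hui huj hsplit
    rw [hsplit, key i hiN qi hqi', key j hjN qj hqj', hui, huj]
    simp only [Polynomial.eval_add, Polynomial.eval_mul, Polynomial.eval_C, Polynomial.eval_X, hθ]
    ring

end Volume

section Triangulation

theorem exists_forall_sum_mul_ne_zero {α ι : Type*} [Finite α] [Fintype ι] (u : α → ι → ℝ)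
    (hu : ∀ a, u a ≠ 0) : ∃ h : ι → ℝ, ∀ a, ∑ i, u a i * h i ≠ 0 := by
  classical
  have : ∀ᵐ h : ι → ℝ, ∀ a, ∑ i, u a i * h i ≠ 0 := by
    rw [ae_all_iff]
    intro a
    have hne : Fintype.linearCombination ℝ (u a) ≠ 0 := by
      intro h0
      refine hu a (funext fun i => ?_)
      simpa using LinearMap.congr_fun h0 (Pi.single i 1)
    have := addHaar_linearMap_eq_const volume (Fintype.linearCombination ℝ (u a)) hne 0
    rw [ae_iff]
    convert this using 3
    simp [Fintype.linearCombination_apply, mul_comm]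
  exact this.exists

variable {ι E : Type*} [Fintype ι] [DecidableEq ι]

theorem sum_dite_smul {M : Type*} [AddCommGroup M] [Module ℝ M] (σ : Finset ι) (w : σ → ℝ)
    (f : ι → M) :
    ∑ i, (if hi : i ∈ σ then w ⟨i, hi⟩ else 0) • f i = ∑ i : σ, w i • f i := by
  rw [← Finset.sum_subset (Finset.subset_univ σ) (by intro i _ hi; simp [hi]),
    ← Finset.sum_coe_sort]
  simp

theorem sum_dite_eq_sum_coe (σ : Finset ι) (w : σ → ℝ) :
    ∑ i, (if hi : i ∈ σ then w ⟨i, hi⟩ else 0) = ∑ i : σ, w i := by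
  simpa using sum_dite_smul σ w fun _ => (1 : ℝ)

theorem mem_convexHull_image_iff [AddCommGroup E] [Module ℝ E] (v : ι → E) (σ : Finset ι) (y : E) :
    y ∈ convexHull ℝ (v '' σ) ↔
      ∃ w ∈ stdSimplex ℝ ι, (∀ i ∉ σ, w i = 0) ∧ ∑ i, w i • v i = y := by
  constructor
  · intro hy
    rw [image_eq_range] at hy
    obtain ⟨w, ⟨hw0, hw1⟩, hw⟩ := (mem_convexHull_range_iff (fun i : σ => v i) y).1 hy
    refine ⟨fun i => if hi : i ∈ σ then w ⟨i, hi⟩ else 0, ⟨fun i => ?_, ?_⟩, ?_, ?_⟩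
    · dsimp only
      split_ifs
      exacts [hw0 _, le_rfl]
    · rw [sum_dite_eq_sum_coe, hw1]
    · intro i hi
      simp [hi]
    · rw [sum_dite_smul, hw]
  · rintro ⟨w, ⟨hw0, hw1⟩, hσ, rfl⟩
    rw [← Finset.sum_subset (Finset.subset_univ σ) (by intro i _ hi; simp [hσ i hi])]
    refine (convex_convexHull ℝ _).sum_mem (fun i _ => hw0 i) ?_
      fun i hi => subset_convexHull ℝ _ (mem_image_of_mem v hi)
    rw [Finset.sum_subset (Finset.subset_univ σ) (by intro i _ hi; simp [hσ i hi]), hw1]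

/-- Affine dependences of `v` supported on `σ ∪ {j}` and normalised at `j`. -/
def IsDependence [AddCommGroup E] [Module ℝ E] (v : ι → E) (σ : Finset ι) (j : ι) (m : ι → ℝ) :
    Prop :=
  ∑ i, m i = 0 ∧ ∑ i, m i • v i = 0 ∧ m j = 1 ∧ ∀ i ∉ σ, i ≠ j → m i = 0

theorem exists_generic_lift [AddCommGroup E] [Module ℝ E] (v : ι → E) :
    ∃ h : ι → ℝ, ∀ σ j, (∃ m, IsDependence v σ j m) →
      ∃ m, IsDependence v σ j m ∧ ∑ i, m i * h i ≠ 0 := by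
  classical
  obtain ⟨h, hh⟩ := exists_forall_sum_mul_ne_zero
    (fun p : Finset ι × ι => if H : ∃ m, IsDependence v p.1 p.2 m then H.choose
      else Pi.single p.2 (1 : ℝ)) (by
      rintro ⟨σ, j⟩ h0
      dsimp only at h0
      split_ifs at h0 with H
      · have := H.choose_spec.2.2.1
        rw [h0] at this
        simp at this
      · simpa using congr_fun h0 j)
  refine ⟨h, fun σ j H => ⟨H.choose, H.choose_spec, ?_⟩⟩
  have := hh (σ, j)
  rwa [dif_pos H] at this

theorem eventually_nonneg_add_mul {a m : ℝ} (ha : 0 ≤ a) (hm : a = 0 → 0 ≤ m) :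
    ∀ᶠ ε in nhdsWithin (0 : ℝ) (Ioi 0), 0 ≤ a + ε * m := by
  rcases ha.eq_or_lt with rfl | hpos
  · filter_upwards [self_mem_nhdsWithin] with ε hε
    simpa using mul_nonneg (le_of_lt hε) (hm rfl)
  · refine Filter.Eventually.filter_mono nhdsWithin_le_nhds ?_
    have hcont : ContinuousAt (fun ε : ℝ => a + ε * m) 0 := by fun_prop
    filter_upwards [hcont.eventually (lt_mem_nhds (show 0 < a + 0 * m by simpa using hpos))]
      with ε hε using hε.le
/-- The cells of the regular subdivision of `v` induced by the heights `h`. -/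
def IsRegularCell [AddCommGroup E] [Module ℝ E] (v : ι → E) (h : ι → ℝ) (σ : Finset ι) : Prop :=
  AffineIndependent ℝ (fun i : σ => v i) ∧ affineSpan ℝ (v '' σ) = ⊤ ∧
    ∃ (f : E →ₗ[ℝ] ℝ) (c : ℝ), (∀ i ∈ σ, f (v i) + c = h i) ∧ ∀ i ∉ σ, f (v i) + c < h i

omit [DecidableEq ι] in
theorem sum_mul_affine [AddCommGroup E] [Module ℝ E] {v : ι → E} {w : ι → ℝ} {p : E}
    (hw : ∑ i, w i • v i = p) (f : E →ₗ[ℝ] ℝ) (c : ℝ) :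
    ∑ i, w i * (f (v i) + c) = f p + (∑ i, w i) * c := by
  simp [← hw, mul_add, Finset.sum_add_distrib, Finset.sum_mul]

theorem exists_extreme_minimizer [AddCommGroup E] [Module ℝ E] [TopologicalSpace E] [T2Space E]
    [ContinuousAdd E] [ContinuousSMul ℝ E] {v : ι → E} (h : ι → ℝ) {p : E}
    (hp : p ∈ convexHull ℝ (range v)) :
    ∃ w ∈ stdSimplex ℝ ι, ∑ i, w i • v i = p ∧
      (∀ m : ι → ℝ, ∑ i, m i = 0 → ∑ i, m i • v i = 0 → (∀ i, w i = 0 → 0 ≤ m i) →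
        0 ≤ ∑ i, m i * h i) ∧
      AffineIndependent ℝ (fun i : Finset.univ.filter (fun i => w i ≠ 0) => v i) := by
  classical
  set Λ := {w | w ∈ stdSimplex ℝ ι ∧ ∑ i, w i • v i = p} with hΛ
  have hcont : Continuous fun w : ι → ℝ => ∑ i, w i • v i := by fun_prop
  have hcost : Continuous fun w : ι → ℝ => ∑ i, w i * h i := by fun_prop
  have hΛc : IsCompact Λ :=
    (isCompact_stdSimplex ℝ ι).inter_right (isClosed_singleton.preimage hcont)
  obtain ⟨w₁, hw₁, hw₁'⟩ := (mem_convexHull_range_iff v p).1 hp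
  obtain ⟨w₀, hw₀, hmin⟩ := hΛc.exists_isMinOn ⟨w₁, hw₁, hw₁'⟩ hcost.continuousOn
  obtain ⟨w, ⟨hwΛ, hwc⟩, hext⟩ := (hΛc.inter_right
    (isClosed_singleton.preimage hcost (t := {∑ i, w₀ i * h i}))).extremePoints_nonempty
    ⟨w₀, hw₀, rfl⟩
  simp only [mem_preimage, mem_singleton_iff] at hwc
  have hpert : ∀ m : ι → ℝ, ∑ i, m i = 0 → ∑ i, m i • v i = 0 → (∀ i, w i = 0 → 0 ≤ m i) →
      ∀ᶠ ε in nhdsWithin (0 : ℝ) (Ioi 0), w + ε • m ∈ Λ := by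
    intro m hm hmv hm0
    filter_upwards [Filter.eventually_all.2 fun i =>
      eventually_nonneg_add_mul (hwΛ.1.1 i) (hm0 i)] with ε hε
    refine ⟨⟨hε, ?_⟩, ?_⟩
    · simp [Finset.sum_add_distrib, ← Finset.mul_sum, hm, hwΛ.1.2]
    · simp [add_smul, Finset.sum_add_distrib, mul_smul, ← Finset.smul_sum, hmv, hwΛ.2]
  have hcostadd : ∀ (m : ι → ℝ) (ε : ℝ),
      ∑ i, (w + ε • m) i * h i = ∑ i, w₀ i * h i + ε * ∑ i, m i * h i := by
    intro m ε
    simp [add_mul, Finset.sum_add_distrib, hwc, Finset.mul_sum, mul_assoc]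
  have hnonneg : ∀ m : ι → ℝ, ∑ i, m i = 0 → ∑ i, m i • v i = 0 → (∀ i, w i = 0 → 0 ≤ m i) →
      0 ≤ ∑ i, m i * h i := by
    intro m hm hmv hm0
    obtain ⟨ε, hε, hε0⟩ := ((hpert m hm hmv hm0).and self_mem_nhdsWithin).exists
    have h1 : ∑ i, w₀ i * h i ≤ ∑ i, (w + ε • m) i * h i := hmin hε
    rw [hcostadd] at h1
    exact nonneg_of_mul_nonneg_right (by linarith) hε0
  refine ⟨w, hwΛ.1, hwΛ.2, hnonneg, ?_⟩
  rw [affineIndependent_iff_of_fintype]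
  intro u hu huv
  rw [Finset.weightedVSub_eq_linear_combination _ hu] at huv
  set m : ι → ℝ := fun i => if hi : i ∈ Finset.univ.filter (fun i => w i ≠ 0) then u ⟨i, hi⟩ else 0
    with hmdef
  have hm : ∑ i, m i = 0 := by rw [hmdef, sum_dite_eq_sum_coe, hu]
  have hmv : ∑ i, m i • v i = 0 := by
    rw [hmdef, sum_dite_smul _ u v]
    exact huv
  have hm0 : ∀ i, w i = 0 → m i = 0 := fun i hi => by simp [hmdef, hi]
  have hm' : ∑ i, (-m) i = 0 := by simp [hm]
  have hmv' : ∑ i, (-m) i • v i = 0 := by simp [hmv]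
  have hm0' : ∀ i, w i = 0 → 0 ≤ (-m) i := fun i hi => by simp [hm0 i hi]
  have hmh : ∑ i, m i * h i = 0 := by
    refine le_antisymm ?_ (hnonneg m hm hmv fun i hi => (hm0 i hi).ge)
    have := hnonneg (-m) hm' hmv' hm0'
    simpa using this
  obtain ⟨ε, ⟨h1, h2⟩, hε⟩ := (((hpert m hm hmv fun i hi => (hm0 i hi).ge).and
    (hpert (-m) hm' hmv' hm0')).and self_mem_nhdsWithin).exists
  have hmem : ∀ r : ℝ, w + r • m ∈ Λ → w + r • m ∈ Λ ∩
      (fun w : ι → ℝ => ∑ i, w i * h i) ⁻¹' {∑ i, w₀ i * h i} := by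
    intro r hr
    refine ⟨hr, ?_⟩
    rw [mem_preimage, mem_singleton_iff, hcostadd, hmh, mul_zero, add_zero]
  have heq := hext (hmem ε h1) (hmem (-ε) (by simpa using h2))
    ⟨1 / 2, 1 / 2, by norm_num, by norm_num, by norm_num, by module⟩
  have hmz : m = 0 := by
    have : ε • m = 0 := by simpa using heq
    exact (smul_eq_zero.1 this).resolve_left (ne_of_gt hε)
  rintro ⟨i, hi⟩
  have := congr_fun hmz i
  simpa [hmdef, (Finset.mem_filter.1 hi).2] using this

theorem exists_regularCell_mem [NormedAddCommGroup E] [NormedSpace ℝ E] {v : ι → E} {h : ι → ℝ}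
    (hh : ∀ σ j, (∃ m, IsDependence v σ j m) → ∃ m, IsDependence v σ j m ∧ ∑ i, m i * h i ≠ 0)
    {p : E} (hp : p ∈ convexHull ℝ (range v))
    (hgen : ∀ τ : Finset ι, affineSpan ℝ (v '' τ) ≠ ⊤ → p ∉ convexHull ℝ (v '' τ)) :
    ∃ σ, IsRegularCell v h σ ∧ p ∈ convexHull ℝ (v '' σ) := by
  classical
  obtain ⟨w, hw, hwp, hmin, hind⟩ := exists_extreme_minimizer h hp
  set σ := Finset.univ.filter (fun i => w i ≠ 0) with hσ
  have hwσ : ∀ i ∉ σ, w i = 0 := fun i hi => by simpa [hσ] using hi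
  have hσw : ∀ i ∈ σ, w i ≠ 0 := fun i hi => by simpa [hσ] using hi
  have hpσ : p ∈ convexHull ℝ (v '' σ) := (mem_convexHull_image_iff v σ p).2 ⟨w, hw, hwσ, hwp⟩
  have hspan : affineSpan ℝ (v '' σ) = ⊤ := by
    by_contra H
    exact hgen σ H hpσ
  let b : AffineBasis σ ℝ E := ⟨fun i : σ => v i, hind, by rw [← hspan, image_eq_range]; rfl⟩
  have hb : ∀ i : σ, b i = v i := fun i => rfl
  set g : E →ᵃ[ℝ] ℝ := ∑ i : σ, h i • b.coord i with hg
  have hgv : ∀ y, g y = g.linear y + g 0 := fun y => congr_fun g.decomp y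
  have hgb : ∀ i ∈ σ, g (v i) = h i := by
    intro i hi
    have hgi : ∀ y, g y = ∑ k : σ, h k * b.coord k y := by
      intro y
      rw [hg]
      induction (Finset.univ : Finset σ) using Finset.induction_on with
      | empty => simp
      | insert a s ha ih => simp [Finset.sum_insert ha, ih]
    rw [hgi, ← hb ⟨i, hi⟩]
    simp [b.coord_apply]
  refine ⟨σ, ⟨hind, hspan, g.linear, g 0, fun i hi => by rw [← hgv, hgb i hi], fun j hj => ?_⟩, hpσ⟩
  obtain ⟨m, ⟨hm, hmv, hmj, hmσ⟩, hne⟩ := hh σ j (by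
    refine ⟨fun i => (if i = j then 1 else 0) -
      (if hi : i ∈ σ then b.coord ⟨i, hi⟩ (v j) else 0), ?_, ?_, ?_, ?_⟩
    · rw [Finset.sum_sub_distrib, sum_dite_eq_sum_coe σ fun i => b.coord i (v j)]
      rw [b.sum_coord_apply_eq_one]
      simp
    · simp only [sub_smul, Finset.sum_sub_distrib]
      rw [sum_dite_smul σ (fun i => b.coord i (v j)) v]
      have hvj : ∑ i : σ, b.coord i (v j) • v i = v j := b.linear_combination_coord_eq_self (v j)
      rw [hvj]
      simp
    · simp [hj]
    · intro i hi hij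
      simp [hi, hij])
  have hpos : 0 < ∑ i, m i * h i := by
    refine lt_of_le_of_ne (hmin m hm hmv fun i hi => ?_) hne.symm
    have hiσ : i ∉ σ := fun h' => hσw i h' hi
    by_cases hij : i = j
    · rw [hij, hmj]; exact zero_le_one
    · exact (hmσ i hiσ hij).ge
  have hzero := sum_mul_affine hmv g.linear (g 0)
  rw [hm, LinearMap.map_zero, zero_mul, add_zero] at hzero
  have hsum : ∑ i, m i * h i = h j - (g.linear (v j) + g 0) := by
    rw [← sub_zero (∑ i, m i * h i), ← hzero, ← Finset.sum_sub_distrib,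
      Finset.sum_eq_single j]
    · rw [hmj]; ring
    · intro i _ hij
      by_cases hi : i ∈ σ
      · rw [← hgv, hgb i hi, sub_self]
      · simp [hmσ i hi hij]
    · simp
  linarith

theorem IsRegularCell.eq_of_mem [AddCommGroup E] [Module ℝ E] {v : ι → E} {h : ι → ℝ}
    {σ τ : Finset ι} (hσ : IsRegularCell v h σ) (hτ : IsRegularCell v h τ) {p : E}
    (hpσ : p ∈ convexHull ℝ (v '' σ)) (hpτ : p ∈ convexHull ℝ (v '' τ))
    (hgen : ∀ τ : Finset ι, affineSpan ℝ (v '' τ) ≠ ⊤ → p ∉ convexHull ℝ (v '' τ)) : σ = τ := by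
  classical
  have hsub : ∀ {σ τ : Finset ι}, IsRegularCell v h σ → affineSpan ℝ (v '' ↑(σ ∩ τ)) = ⊤ →
      σ ⊆ τ := by
    intro σ τ hσ hst i hi
    have himg : v '' ↑(σ ∩ τ) = (fun i : σ => v i) '' {i | (i : ι) ∈ τ} := by
      ext y
      simp only [mem_image, Finset.mem_coe, Finset.mem_inter, mem_ofPred_eq, Subtype.exists]
      constructor
      · rintro ⟨k, ⟨hk, hk'⟩, rfl⟩
        exact ⟨k, hk, hk', rfl⟩
      · rintro ⟨k, hk, hk', rfl⟩
        exact ⟨k, ⟨hk, hk'⟩, rfl⟩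
    have := (hσ.1.mem_affineSpan_iff ⟨i, hi⟩ {i | (i : ι) ∈ τ}).1 (by
      rw [← himg, hst]; trivial)
    exact this
  have hle : ∀ {σ τ : Finset ι} {f f' : E →ₗ[ℝ] ℝ} {c c' : ℝ} {w : ι → ℝ}, w ∈ stdSimplex ℝ ι →
      (∀ i ∉ τ, w i = 0) → ∑ i, w i • v i = p →
      (∀ i ∈ σ, f (v i) + c = h i) → (∀ i ∉ σ, f (v i) + c < h i) →
      (∀ i ∈ τ, f' (v i) + c' = h i) →
      f p + c ≤ f' p + c' ∧ (f p + c = f' p + c' → ∀ i ∉ σ, w i = 0) := by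
    intro σ τ f f' c c' w hw hwτ hwp hσ1 hσ2 hτ1
    have e1 := sum_mul_affine hwp f c
    have e2 := sum_mul_affine hwp f' c'
    rw [hw.2, one_mul] at e1 e2
    have hall : ∀ i ∈ Finset.univ, w i * (f (v i) + c) ≤ w i * (f' (v i) + c') := by
      intro i _
      by_cases hi : i ∈ τ
      · refine mul_le_mul_of_nonneg_left ?_ (hw.1 i)
        rw [hτ1 i hi]
        by_cases hi' : i ∈ σ
        · exact (hσ1 i hi').le
        · exact (hσ2 i hi').le
      · simp [hwτ i hi]
    rw [← e1, ← e2]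
    refine ⟨Finset.sum_le_sum hall, fun heq i hi => ?_⟩
    have := (Finset.sum_eq_sum_iff_of_le hall).1 heq i (Finset.mem_univ i)
    by_contra hwi
    have hiτ : i ∈ τ := by
      by_contra h'
      exact hwi (hwτ i h')
    have := mul_left_cancel₀ hwi this
    rw [hτ1 i hiτ] at this
    exact (hσ2 i hi).ne this
  obtain ⟨f, c, hf1, hf2⟩ := hσ.2.2
  obtain ⟨f', c', hf1', hf2'⟩ := hτ.2.2
  obtain ⟨w, hw, hwσ, hwp⟩ := (mem_convexHull_image_iff v σ p).1 hpσ
  obtain ⟨w', hw', hwτ, hwp'⟩ := (mem_convexHull_image_iff v τ p).1 hpτ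
  have h1 := hle hw' hwτ hwp' hf1 hf2 hf1'
  have h2 := hle hw hwσ hwp hf1' hf2' hf1
  have h3 := h1.2 (le_antisymm h1.1 h2.1)
  have hmem : p ∈ convexHull ℝ (v '' ↑(σ ∩ τ)) := by
    refine (mem_convexHull_image_iff v _ p).2 ⟨w', hw', fun i hi => ?_, hwp'⟩
    by_cases hi' : i ∈ σ
    · exact hwτ i fun h' => hi (Finset.mem_inter.2 ⟨hi', h'⟩)
    · exact h3 i hi'
  have hspan : affineSpan ℝ (v '' ↑(σ ∩ τ)) = ⊤ := by
    by_contra H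
    exact hgen _ H hmem
  exact (hsub hσ hspan).antisymm (hsub hτ (by rwa [Finset.inter_comm]))

/-- Every polytope has a triangulation without new vertices, up to null sets. -/
theorem exists_triangulation [NormedAddCommGroup E] [NormedSpace ℝ E] [FiniteDimensional ℝ E]
    [MeasurableSpace E] [BorelSpace E] (μ : Measure E) [μ.IsAddHaarMeasure] (v : ι → E) :
    ∃ 𝒯 : Finset (Finset ι), (∀ σ ∈ 𝒯, AffineIndependent ℝ (fun i : σ => v i) ∧
        affineSpan ℝ (v '' σ) = ⊤) ∧
      ∀ A : Set E, MeasurableSet A → μ.real (convexHull ℝ (range v) ∩ A) =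
        ∑ σ ∈ 𝒯, μ.real (convexHull ℝ (v '' σ) ∩ A) := by
  classical
  obtain ⟨h, hh⟩ := exists_generic_lift v
  have hgen : ∀ᵐ p ∂μ, ∀ τ : Finset ι, affineSpan ℝ (v '' τ) ≠ ⊤ → p ∉ convexHull ℝ (v '' τ) := by
    rw [ae_all_iff]
    intro τ
    by_cases hτ : affineSpan ℝ (v '' τ) = ⊤
    · simp [hτ]
    · rw [ae_iff]
      simpa [hτ] using addHaar_convexHull_eq_zero μ hτ
  refine ⟨Finset.univ.filter (IsRegularCell v h), fun σ hσ => ?_, fun A hA => ?_⟩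
  · have := (Finset.mem_filter.1 hσ).2
    exact ⟨this.1, this.2.1⟩
  have hmeas : ∀ σ : Finset ι, MeasurableSet (convexHull ℝ (v '' σ) ∩ A) := fun σ =>
    ((σ.finite_toSet.image v).isCompact_convexHull ℝ).measurableSet.inter hA
  have hfin : ∀ σ : Finset ι, μ (convexHull ℝ (v '' σ) ∩ A) ≠ ⊤ := fun σ =>
    ((measure_mono inter_subset_left).trans_lt
      ((σ.finite_toSet.image v).isCompact_convexHull ℝ).measure_lt_top).ne
  rw [← measureReal_biUnion_finset₀ ?_ (fun σ _ => (hmeas σ).nullMeasurableSet) fun σ _ => hfin σ]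
  · apply measureReal_congr
    filter_upwards [hgen] with p hp
    apply propext
    change p ∈ convexHull ℝ (range v) ∩ A ↔ p ∈ ⋃ σ ∈ Finset.univ.filter (IsRegularCell v h), convexHull ℝ (v '' σ) ∩ A
    simp only [mem_iUnion, Finset.mem_filter, Finset.mem_univ, true_and]
    constructor
    · rintro ⟨hpv, hpA⟩
      obtain ⟨σ, hσ, hpσ⟩ := exists_regularCell_mem hh hpv hp
      exact ⟨σ, hσ, hpσ, hpA⟩
    · rintro ⟨σ, hσ, hpσ, hpA⟩
      exact ⟨convexHull_mono (image_subset_range v σ) hpσ, hpA⟩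
  · intro σ hσ τ hτ hne
    refine measure_mono_null ?_ (ae_iff.1 hgen)
    rintro p ⟨hp1, hp2⟩ hp
    exact hne ((Finset.mem_filter.1 hσ).2.eq_of_mem (Finset.mem_filter.1 hτ).2 hp1.1 hp2.1 hp)

end Triangulation

section Slices

open Module

theorem exists_polynomial_addHaar_convexHull {ι E : Type*} [Finite ι] [NormedAddCommGroup E]
    [NormedSpace ℝ E] [FiniteDimensional ℝ E] [MeasurableSpace E] [BorelSpace E] (μ : Measure E)
    [μ.IsAddHaarMeasure] (v : ι → E) {h : E →ₗ[ℝ] ℝ} (hh : h ≠ 0) {J : Set ℝ} (hJ : J.Nonempty)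
    (hv : ∀ i, (∀ s ∈ J, h (v i) < s) ∨ (∀ s ∈ J, s < h (v i))) :
    ∃ q : Polynomial ℝ, q.natDegree ≤ finrank ℝ E ∧
      ∀ s ∈ J, μ.real (convexHull ℝ (range v) ∩ {y | h y ≤ s}) = q.eval s := by
  classical
  have := Fintype.ofFinite ι
  obtain ⟨𝒯, h𝒯, hsum⟩ := exists_triangulation μ v
  have hσ : ∀ σ ∈ 𝒯, ∃ q : Polynomial ℝ, q.natDegree ≤ finrank ℝ E ∧
      ∀ s ∈ J, μ.real (convexHull ℝ (v '' σ) ∩ {y | h y ≤ s}) = q.eval s := by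
    intro σ hσ
    have hcard : Fintype.card σ = finrank ℝ E + 1 := by
      rw [← (h𝒯 σ hσ).1.affineSpan_eq_top_iff_card_eq_finrank_add_one, ← (h𝒯 σ hσ).2,
        image_eq_range]
      rfl
    obtain ⟨q, hq, hqs⟩ := exists_polynomial_addHaar_simplex μ hcard hh hJ (fun i : σ => h (v i))
      (fun i => hv i) Finset.univ
    have himg : v '' σ = range fun i : σ => v i := image_eq_range _ _
    refine ⟨q * Polynomial.C (μ.real (convexHull ℝ (v '' σ))), ?_, fun s hs => ?_⟩
    · refine (Polynomial.natDegree_mul_C_le _ _).trans (hq.trans ?_)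
      rw [Finset.card_univ, hcard, Nat.add_sub_cancel]
    · rw [Polynomial.eval_mul, Polynomial.eval_C, himg]
      exact hqs s hs _ (fun i _ => rfl) fun i hi => absurd (Finset.mem_univ i) hi
  choose! q hq hqs using hσ
  refine ⟨∑ σ ∈ 𝒯, q σ, Polynomial.natDegree_sum_le_of_forall_le _ _ hq, fun s hs => ?_⟩
  rw [hsum _ (measurableSet_le h.continuous_of_finiteDimensional.measurable measurable_const),
    Polynomial.eval_finsetSum]
  exact Finset.sum_congr rfl fun σ hσ => hqs σ hσ s hs

variable {E : Type*} [NormedAddCommGroup E] [InnerProductSpace ℝ E] [FiniteDimensional ℝ E]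
  [MeasurableSpace E] [BorelSpace E] {x : E}

omit [FiniteDimensional ℝ E] [MeasurableSpace E] [BorelSpace E] in
theorem inner_inv_smul_add (hx : x ≠ 0) (s : ℝ) (k : (ℝ ∙ x)ᗮ) :
    ⟪x, s • ((‖x‖ ^ 2)⁻¹ • x) + (k : E)⟫ = s := by
  have hk : ⟪x, (k : E)⟫ = 0 := Submodule.mem_orthogonal_singleton_iff_inner_right.1 k.2
  have : ‖x‖ ^ 2 ≠ 0 := by simpa using hx
  rw [inner_add_right, hk, inner_smul_right, inner_smul_right, real_inner_self_eq_norm_sq]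
  field_simp
  simp

omit [MeasurableSpace E] [BorelSpace E] in
theorem finrank_orthogonal_singleton_cast (hx : x ≠ 0) :
    (finrank ℝ (ℝ ∙ x)ᗮ : ℝ) = finrank ℝ E - 1 := by
  rw [← (ℝ ∙ x).finrank_add_finrank_orthogonal, finrank_span_singleton hx]
  push_cast
  ring

omit [FiniteDimensional ℝ E] [MeasurableSpace E] [BorelSpace E] in
theorem inter_inner_eq_image (hx : x ≠ 0) (A : Set E) (s : ℝ) :
    A ∩ {y | ⟪x, y⟫ = s} = (fun k : (ℝ ∙ x)ᗮ => s • ((‖x‖ ^ 2)⁻¹ • x) + (k : E)) ''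
      {k | s • ((‖x‖ ^ 2)⁻¹ • x) + (k : E) ∈ A} := by
  ext y
  constructor
  · rintro ⟨hy, hys⟩
    refine ⟨⟨y - s • ((‖x‖ ^ 2)⁻¹ • x), ?_⟩, ?_, ?_⟩
    · rw [Submodule.mem_orthogonal_singleton_iff_inner_right, inner_sub_right, sub_eq_zero]
      have := inner_inv_smul_add hx s 0
      simp only [ZeroMemClass.coe_zero, add_zero] at this
      rw [this]
      exact hys
    · simpa using hy
    · simp
  · rintro ⟨k, hk, rfl⟩
    exact ⟨hk, inner_inv_smul_add hx s k⟩

theorem hausdorffMeasure_inter_inner_eq (hx : x ≠ 0) (A : Set E) (s : ℝ) :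
    μH[(finrank ℝ E : ℝ) - 1] (A ∩ {y | ⟪x, y⟫ = s}) = μH[(finrank ℝ (ℝ ∙ x)ᗮ : ℝ)]
      {k : (ℝ ∙ x)ᗮ | s • ((‖x‖ ^ 2)⁻¹ • x) + (k : E) ∈ A} := by
  rw [inter_inner_eq_image hx, ← finrank_orthogonal_singleton_cast hx]
  refine Isometry.hausdorffMeasure_image (isometry_iff_dist_eq.2 fun k k' => ?_)
    (Or.inl (Nat.cast_nonneg _)) _
  rw [dist_add_left]
  rfl

theorem hausdorffMeasure_inter_inner_ne_top (hx : x ≠ 0) {A : Set E} (hA : IsCompact A) (s : ℝ) :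
    μH[(finrank ℝ E : ℝ) - 1] (A ∩ {y | ⟪x, y⟫ = s}) ≠ ⊤ := by
  have := isAddHaarMeasure_hausdorffMeasure (E := (ℝ ∙ x)ᗮ)
  rw [hausdorffMeasure_inter_inner_eq hx]
  have hiso : Isometry fun k : (ℝ ∙ x)ᗮ => s • ((‖x‖ ^ 2)⁻¹ • x) + (k : E) :=
    isometry_iff_dist_eq.2 fun k k' => by rw [dist_add_left]; rfl
  have hcl : IsCompact {k : (ℝ ∙ x)ᗮ | s • ((‖x‖ ^ 2)⁻¹ • x) + (k : E) ∈ A} :=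
    hiso.isClosedEmbedding.isCompact_preimage hA
  exact hcl.measure_lt_top.ne

/-- Cavalieri's principle for slices by parallel hyperplanes. -/
theorem exists_addHaar_eq_mul_lintegral_hausdorffMeasure (μ : Measure E) [μ.IsAddHaarMeasure]
    (hx : x ≠ 0) : ∃ c : NNReal, 0 < c ∧ ∀ A : Set E, MeasurableSet A →
      (Measurable fun s => μH[(finrank ℝ E : ℝ) - 1] (A ∩ {y | ⟪x, y⟫ = s})) ∧
      μ A = c * ∫⁻ s, μH[(finrank ℝ E : ℝ) - 1] (A ∩ {y | ⟪x, y⟫ = s}) := by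
  have := isAddHaarMeasure_hausdorffMeasure (E := (ℝ ∙ x)ᗮ)
  set u := (‖x‖ ^ 2)⁻¹ • x with hu
  let Φ : (ℝ × (ℝ ∙ x)ᗮ) →ₗ[ℝ] E :=
    (LinearMap.toSpanSingleton ℝ E u).coprod (ℝ ∙ x)ᗮ.subtype
  have hΦ : ∀ p, Φ p = p.1 • u + (p.2 : E) := fun p => rfl
  have hbij : Function.Bijective Φ := by
    constructor
    · rintro ⟨s, k⟩ ⟨s', k'⟩ hp
      simp only [hΦ] at hp
      have hs : s = s' := by
        rw [← inner_inv_smul_add hx s k, ← hu, hp, hu, inner_inv_smul_add hx]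
      subst hs
      rw [Prod.mk.injEq]
      exact ⟨rfl, Subtype.ext (add_left_cancel hp)⟩
    · intro y
      have hy : y ∈ univ ∩ {z | ⟪x, z⟫ = ⟪x, y⟫} := ⟨trivial, rfl⟩
      rw [inter_inner_eq_image hx] at hy
      obtain ⟨k, -, hk⟩ := hy
      exact ⟨(⟪x, y⟫, k), hk⟩
  let Ψ := (LinearEquiv.ofBijective Φ hbij).toContinuousLinearEquiv
  have hΨ : ∀ p, Ψ p = p.1 • u + (p.2 : E) := fun p => rfl
  let ν : Measure E := Measure.map Ψ ((volume : Measure ℝ).prod μH[(finrank ℝ (ℝ ∙ x)ᗮ : ℝ)])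
  have hν : ν.IsAddHaarMeasure := Ψ.isAddHaarMeasure_map _
  refine ⟨μ.addHaarScalarFactor ν, Measure.addHaarScalarFactor_pos_of_isAddHaarMeasure _ _,
    fun A hA => ?_⟩
  have hpre : MeasurableSet (Ψ ⁻¹' A) := Ψ.continuous.measurable hA
  have hslice : (fun s => μH[(finrank ℝ E : ℝ) - 1] (A ∩ {y | ⟪x, y⟫ = s})) =
      fun s => μH[(finrank ℝ (ℝ ∙ x)ᗮ : ℝ)] (Prod.mk s ⁻¹' (Ψ ⁻¹' A)) :=
    funext fun s => hausdorffMeasure_inter_inner_eq hx A s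
  rw [hslice]
  refine ⟨measurable_measure_prodMk_left hpre, ?_⟩
  rw [← Measure.prod_apply hpre, ← Measure.map_apply Ψ.continuous.measurable hA]
  conv_lhs => rw [Measure.isAddLeftInvariant_eq_smul μ ν]
  rfl

theorem rpow_mul_hausdorffMeasure_slice_le (hx : x ≠ 0) {P : Set E} (hP : IsCompact P)
    (hconv : Convex ℝ P) {y : E} (hy : y ∈ P) {l s r : ℝ} (hl : 0 < l) (hl1 : l ≤ 1)
    (hr : r = ⟪x, y⟫ + l * (s - ⟪x, y⟫)) :
    l ^ ((finrank ℝ E : ℝ) - 1) * (μH[(finrank ℝ E : ℝ) - 1] (P ∩ {z | ⟪x, z⟫ = s})).toReal ≤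
      (μH[(finrank ℝ E : ℝ) - 1] (P ∩ {z | ⟪x, z⟫ = r})).toReal := by
  have hD : 0 ≤ (finrank ℝ E : ℝ) - 1 := by
    rw [← finrank_orthogonal_singleton_cast hx]
    exact Nat.cast_nonneg _
  have hsub : AffineMap.homothety y l '' (P ∩ {z | ⟪x, z⟫ = s}) ⊆ P ∩ {z | ⟪x, z⟫ = r} := by
    rintro _ ⟨z, ⟨hz, hzs⟩, rfl⟩
    rw [mem_ofPred_eq] at hzs
    rw [AffineMap.homothety_apply, vsub_eq_sub, vadd_eq_add, add_comm]
    refine ⟨hconv.add_smul_sub_mem hy hz ⟨hl.le, hl1⟩, ?_⟩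
    rw [mem_ofPred_eq, inner_add_right, inner_smul_right, inner_sub_right, hzs, hr]
  have := ENNReal.toReal_mono (hausdorffMeasure_inter_inner_ne_top hx hP r) (measure_mono hsub)
  rw [hausdorffMeasure_homothety_image hD y hl.ne'] at this
  rw [ENNReal.smul_def, smul_eq_mul, ENNReal.toReal_mul, ENNReal.coe_toReal, NNReal.coe_rpow,
    coe_nnnorm, Real.norm_of_nonneg hl.le] at this
  exact this

theorem continuousAt_hausdorffMeasure_slice (hx : x ≠ 0) {P : Set E} (hP : IsCompact P)
    (hconv : Convex ℝ P) {s : ℝ}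
    (hs : (∃ y ∈ P, ⟪x, y⟫ = s) → (∃ y ∈ P, ⟪x, y⟫ < s) ∧ ∃ y ∈ P, s < ⟪x, y⟫) :
    ContinuousAt (fun r => (μH[(finrank ℝ E : ℝ) - 1] (P ∩ {z | ⟪x, z⟫ = r})).toReal) s := by
  set g := fun r => (μH[(finrank ℝ E : ℝ) - 1] (P ∩ {z | ⟪x, z⟫ = r})).toReal with hg
  set D := (finrank ℝ E : ℝ) - 1 with hD
  by_cases hmem : ∃ y ∈ P, ⟪x, y⟫ = s
  · obtain ⟨⟨y₁, hy₁, hm⟩, y₂, hy₂, hM⟩ := hs hmem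
    set m := ⟪x, y₁⟫ with hm_def
    set M := ⟪x, y₂⟫ with hM_def
    set A : ℝ → ℝ := fun r => ((r - m) / (s - m)) ^ D with hA
    set B : ℝ → ℝ := fun r => ((M - r) / (M - s)) ^ D with hB
    have hsm : s - m ≠ 0 := (sub_pos.2 hm).ne'
    have hMs : M - s ≠ 0 := (sub_pos.2 hM).ne'
    have hAs : A s = 1 := by simp [hA, div_self hsm]
    have hBs : B s = 1 := by simp [hB, div_self hMs]
    have hAc : ContinuousAt A s := by
      refine ContinuousAt.rpow_const (by fun_prop) (Or.inl ?_)
      simp [div_self hsm]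
    have hBc : ContinuousAt B s := by
      refine ContinuousAt.rpow_const (by fun_prop) (Or.inl ?_)
      simp [div_self hMs]
    have hlow : Filter.Tendsto (fun r => min (A r * g s) (B r * g s)) (nhds s) (nhds (g s)) := by
      have := (hAc.mul_const (g s)).min (hBc.mul_const (g s))
      simpa [hAs, hBs] using this
    have hupp : Filter.Tendsto (fun r => max (A r * g s) (B r * g s)) (nhds s) (nhds (g s)) := by
      have := (hAc.mul_const (g s)).max (hBc.mul_const (g s))
      simpa [hAs, hBs] using this
    have hinv : ∀ {a u w : ℝ}, 0 < a → a⁻¹ ^ D * u ≤ w → u ≤ a ^ D * w := by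
      intro a u w ha hle
      rw [Real.inv_rpow ha.le] at hle
      exact (inv_mul_le_iff₀ (Real.rpow_pos_of_pos ha D)).1 hle
    have hbd : ∀ r ∈ Ioo m M, min (A r * g s) (B r * g s) ≤ g r ∧
        g r ≤ max (A r * g s) (B r * g s) := by
      intro r hr
      have hrm : 0 < r - m := sub_pos.2 hr.1
      have hMr : 0 < M - r := sub_pos.2 hr.2
      have hsm' : 0 < s - m := sub_pos.2 hm
      have hMs' : 0 < M - s := sub_pos.2 hM
      rcases le_total r s with hrs | hrs
      · refine ⟨min_le_of_left_le ?_, le_max_of_le_right (hinv (div_pos hMr hMs') ?_)⟩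
        · exact rpow_mul_hausdorffMeasure_slice_le hx hP hconv hy₁ (div_pos hrm hsm')
            ((div_le_one hsm').2 (by linarith)) (by rw [← hm_def]; field_simp; ring)
        · rw [inv_div]
          exact rpow_mul_hausdorffMeasure_slice_le hx hP hconv hy₂ (div_pos hMs' hMr)
            ((div_le_one hMr).2 (by linarith)) (by rw [← hM_def]; field_simp; ring)
      · refine ⟨min_le_of_right_le ?_, le_max_of_le_left (hinv (div_pos hrm hsm') ?_)⟩
        · exact rpow_mul_hausdorffMeasure_slice_le hx hP hconv hy₂ (div_pos hMr hMs')
            ((div_le_one hMs').2 (by linarith)) (by rw [← hM_def]; field_simp; ring)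
        · rw [inv_div]
          exact rpow_mul_hausdorffMeasure_slice_le hx hP hconv hy₁ (div_pos hsm' hrm)
            ((div_le_one hrm).2 (by linarith)) (by rw [← hm_def]; field_simp; ring)
    have hnear := Ioo_mem_nhds hm hM
    exact tendsto_of_tendsto_of_tendsto_of_le_of_le' hlow hupp
      (Filter.mem_of_superset hnear fun r hr => (hbd r hr).1)
      (Filter.mem_of_superset hnear fun r hr => (hbd r hr).2)
  · have hcl : IsClosed ((fun y => ⟪x, y⟫) '' P) :=
      (hP.image (by fun_prop)).isClosed
    have hev : g =ᶠ[nhds s] fun _ => 0 := by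
      filter_upwards [hcl.isOpen_compl.mem_nhds (show s ∈ ((fun y => ⟪x, y⟫) '' P)ᶜ from hmem)]
        with r hr
      have : P ∩ {z | ⟪x, z⟫ = r} = ∅ := by
        rw [eq_empty_iff_forall_notMem]
        rintro z ⟨hz, hzr⟩
        exact hr ⟨z, hz, hzr⟩
      simp [hg, this]
    exact continuousAt_const.congr hev.symm

theorem hasDerivAt_addHaar_halfspace (μ : Measure E) [μ.IsAddHaarMeasure] (hx : x ≠ 0) :
    ∃ c : ℝ, 0 < c ∧ ∀ P : Set E, IsCompact P → ∀ s,
      ContinuousAt (fun r => (μH[(finrank ℝ E : ℝ) - 1] (P ∩ {z | ⟪x, z⟫ = r})).toReal) s →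
      HasDerivAt (fun r => μ.real (P ∩ {y | ⟪x, y⟫ ≤ r}))
        (c * (μH[(finrank ℝ E : ℝ) - 1] (P ∩ {z | ⟪x, z⟫ = s})).toReal) s := by
  obtain ⟨c, hc, hfub⟩ := exists_addHaar_eq_mul_lintegral_hausdorffMeasure μ hx
  refine ⟨c, hc, fun P hP s hs => ?_⟩
  obtain ⟨hmeas, hvol⟩ := hfub P hP.measurableSet
  set f := fun s => μH[(finrank ℝ E : ℝ) - 1] (P ∩ {y | ⟪x, y⟫ = s}) with hf
  have hfin : ∫⁻ s, f s ≠ ⊤ := by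
    intro H
    rw [H, ENNReal.mul_top (by simpa using hc.ne')] at hvol
    exact hP.measure_lt_top.ne hvol
  have hint : Integrable fun s => (f s).toReal :=
    integrable_toReal_of_lintegral_ne_top hmeas.aemeasurable hfin
  have hhalf : ∀ r, μ.real (P ∩ {y | ⟪x, y⟫ ≤ r}) = c * ∫ s in Iic r, (f s).toReal := by
    intro r
    have hcl : MeasurableSet (P ∩ {y | ⟪x, y⟫ ≤ r}) :=
      hP.measurableSet.inter (measurableSet_le (by fun_prop) measurable_const)
    have hsl : (fun s => μH[(finrank ℝ E : ℝ) - 1] (P ∩ {y | ⟪x, y⟫ ≤ r} ∩ {y | ⟪x, y⟫ = s})) =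
        (Iic r).indicator f := by
      funext s
      by_cases hsr : s ∈ Iic r
      · rw [indicator_of_mem hsr]
        congr 1
        ext y
        simp only [mem_inter_iff, mem_ofPred_eq]
        exact ⟨fun h => ⟨h.1.1, h.2⟩, fun h => ⟨⟨h.1, h.2.trans_le hsr⟩, h.2⟩⟩
      · rw [indicator_of_notMem hsr]
        have : P ∩ {y | ⟪x, y⟫ ≤ r} ∩ {y | ⟪x, y⟫ = s} = ∅ := by
          rw [eq_empty_iff_forall_notMem]
          rintro y ⟨⟨-, h1⟩, h2⟩
          rw [mem_ofPred_eq] at h1 h2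
          exact hsr (h2 ▸ h1)
        rw [this, measure_empty]
    rw [integral_toReal hmeas.aemeasurable
      (ae_restrict_of_ae (ae_lt_top hmeas hfin)), measureReal_def, (hfub _ hcl).2, hsl,
      lintegral_indicator measurableSet_Iic, ENNReal.toReal_mul]
    rfl
  have hsm : StronglyMeasurableAtFilter (fun s => (f s).toReal) (nhds s) volume :=
    hmeas.ennreal_toReal.stronglyMeasurable.stronglyMeasurableAtFilter
  have hder := (intervalIntegral.integral_hasDerivAt_right
    (hint.intervalIntegrable (a := 0) (b := s)) hsm hs).const_add
      (∫ s in Iic 0, (f s).toReal) |>.const_mul (c : ℝ)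
  refine hder.congr_of_eventuallyEq (Filter.Eventually.of_forall fun r => ?_)
  dsimp only
  rw [hhalf, ← intervalIntegral.integral_Iic_sub_Iic hint.integrableOn hint.integrableOn,
    add_sub_cancel]

omit [FiniteDimensional ℝ E] [MeasurableSpace E] [BorelSpace E] in
theorem exists_inner_lt_and_exists_lt_inner {ι : Type*} [Finite ι] {v : ι → E} {s : ℝ}
    (hv : ∀ i, ⟪x, v i⟫ ≠ s) (hs : ∃ y ∈ convexHull ℝ (range v), ⟪x, y⟫ = s) :
    (∃ y ∈ convexHull ℝ (range v), ⟪x, y⟫ < s) ∧ ∃ y ∈ convexHull ℝ (range v), s < ⟪x, y⟫ := by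
  obtain ⟨y, hy, hys⟩ := hs
  have hmem : ∀ i, v i ∈ convexHull ℝ (range v) := fun i => subset_convexHull ℝ _ ⟨i, rfl⟩
  constructor
  · by_contra! H
    have hconv : Convex ℝ {z : E | s < ⟪x, z⟫} :=
      convex_halfSpace_gt (innerₗ E x).isLinear s
    have := convexHull_min (s := range v) (by
      rintro _ ⟨i, rfl⟩
      exact lt_of_le_of_ne (H _ (hmem i)) (hv i).symm) hconv hy
    exact this.ne hys.symm
  · by_contra! H
    have hconv : Convex ℝ {z : E | ⟪x, z⟫ < s} :=
      convex_halfSpace_lt (innerₗ E x).isLinear s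
    have := convexHull_min (s := range v) (by
      rintro _ ⟨i, rfl⟩
      exact lt_of_le_of_ne (H _ (hmem i)) (hv i)) hconv hy
    exact this.ne hys

/-- Between consecutive vertex heights, the area of the slices of a polytope is a polynomial
in the height. -/
theorem exists_polynomial_hausdorffMeasure_slice {ι : Type*} [Finite ι] (v : ι → E) (hx : x ≠ 0)
    {J : Set ℝ} (hJo : IsOpen J) (hJc : IsPreconnected J) (hJ : J.Nonempty)
    (hv : ∀ i, ⟪x, v i⟫ ∉ J) :
    ∃ q : Polynomial ℝ, q.natDegree ≤ finrank ℝ E - 1 ∧ ∀ s ∈ J,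
      (μH[(finrank ℝ E : ℝ) - 1] (convexHull ℝ (range v) ∩ {z | ⟪x, z⟫ = s})).toReal =
        q.eval s := by
  have := isAddHaarMeasure_hausdorffMeasure (E := E)
  set P := convexHull ℝ (range v) with hP_def
  have hP : IsCompact P := (finite_range v).isCompact_convexHull ℝ
  have hsep : ∀ i, (∀ s ∈ J, innerₗ E x (v i) < s) ∨ (∀ s ∈ J, s < innerₗ E x (v i)) := by
    intro i
    by_contra! H
    obtain ⟨⟨a, ha, hai⟩, b, hb, hbi⟩ := H
    exact hv i (hJc.ordConnected.out ha hb ⟨hai, hbi⟩)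
  have hne : innerₗ E x ≠ 0 := fun H => hx (by
    have := LinearMap.congr_fun H x
    simpa using this)
  obtain ⟨q, hq, hqs⟩ := exists_polynomial_addHaar_convexHull μH[(finrank ℝ E : ℝ)] v hne hJ hsep
  obtain ⟨c, hc, hder⟩ := hasDerivAt_addHaar_halfspace μH[(finrank ℝ E : ℝ)] hx
  refine ⟨Polynomial.C c⁻¹ * Polynomial.derivative q, ?_, fun s hs => ?_⟩
  · exact (Polynomial.natDegree_C_mul_le _ _).trans ((Polynomial.natDegree_derivative_le q).trans
      (Nat.sub_le_sub_right hq 1))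
  have hcont := continuousAt_hausdorffMeasure_slice hx hP (convex_convexHull ℝ _)
    (exists_inner_lt_and_exists_lt_inner (v := v) fun i h => hv i (h ▸ hs))
  have hd := (hder P hP s hcont).congr_of_eventuallyEq (f₁ := fun s => q.eval s) (by
    filter_upwards [hJo.mem_nhds hs] with r hr
    exact (hqs r hr).symm)
  rw [Polynomial.eval_mul, Polynomial.eval_C, ← hd.unique (q.hasDerivAt s),
    inv_mul_cancel_left₀ hc.ne']

end Slices

theorem MvPolynomial.totalDegree_aeval_le {R σ : Type*} [CommSemiring R] (q : Polynomial R)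
    {f : MvPolynomial σ R} (hf : f.totalDegree ≤ 1) :
    (Polynomial.aeval f q).totalDegree ≤ q.natDegree := by
  rw [Polynomial.aeval_eq_sum_range]
  refine (MvPolynomial.totalDegree_finsetSum _ _).trans (Finset.sup_le fun i hi => ?_)
  refine (MvPolynomial.totalDegree_smul_le _ _).trans ((MvPolynomial.totalDegree_pow _ _).trans ?_)
  have := Finset.mem_range.1 hi
  nlinarith

theorem image_add_right_inter_perp {d : ℕ} (P : Set (EuclideanSpace ℝ (Fin d)))
    (x t : EuclideanSpace ℝ (Fin d)) :
    ((fun p => p + t) '' P) ∩ perp x = IsometryEquiv.addRight t '' (P ∩ {z | ⟪x, z⟫ = -⟪x, t⟫}) := by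
  ext y
  simp only [perp, mem_inter_iff, mem_image, mem_ofPred_eq, IsometryEquiv.addRight_apply]
  constructor
  · rintro ⟨⟨p, hp, rfl⟩, hy⟩
    rw [inner_add_right] at hy
    exact ⟨p, ⟨hp, eq_neg_of_add_eq_zero_left hy⟩, rfl⟩
  · rintro ⟨p, ⟨hp, hpt⟩, rfl⟩
    exact ⟨⟨p, hp, rfl⟩, by rw [inner_add_right, hpt, neg_add_cancel]⟩

end

/-- Let `P ⊆ ℝ^d` be a full-dimensional polytope with vertex set `V`, fix
`x ≠ 0`, and let `T_x = {t : ⟨x, v + t⟩ ≠ 0 for all v ∈ V}`. On each connected component of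
`T_x`, the function `t ↦ vol_{d-1}((P + t) ∩ x^⊥)` is a polynomial in `t₁, …, t_d` of total
degree at most `d - 1` (and hence so is `t ↦ ρ_{I(P+t)}(x)`, up to the factor `1/‖x‖`). -/
theorem statement_9 (d : ℕ) (hd : 1 ≤ d) (P : Set (EuclideanSpace ℝ (Fin d)))
    (hpoly : IsPolytope P) (hfull : (interior P).Nonempty)
    (x : EuclideanSpace ℝ (Fin d)) (hx : x ≠ 0)
    (T : Set (EuclideanSpace ℝ (Fin d)))
    (hT : T = {t | ∀ v ∈ P.extremePoints ℝ, ⟪x, v + t⟫ ≠ 0})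
    (t₀ : EuclideanSpace ℝ (Fin d)) (ht₀ : t₀ ∈ T) :
    ∃ q : MvPolynomial (Fin d) ℝ, q.totalDegree ≤ d - 1 ∧
      ∀ t ∈ connectedComponentIn T t₀,
        (μH[(d : ℝ) - 1] (((fun p => p + t) '' P) ∩ perp x)).toReal
          = MvPolynomial.eval (fun i => t i) q := by
  obtain ⟨S, hS⟩ := hpoly
  set V := P.extremePoints ℝ with hV
  have hVfin : V.Finite := S.finite_toSet.subset (by rw [hV, hS]; exact extremePoints_convexHull_subset)
  have hPV : P = convexHull ℝ (Set.range ((↑) : V → EuclideanSpace ℝ (Fin d))) := by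
    have hcomp : IsCompact P := hS ▸ S.finite_toSet.isCompact_convexHull ℝ
    have hconv : Convex ℝ P := hS ▸ convex_convexHull ℝ _
    rw [Subtype.range_coe, ← (hVfin.isCompact_convexHull ℝ).isClosed.closure_eq, hV,
      closure_convexHull_extremePoints hcomp hconv]
  have := hVfin.to_subtype
  set U : Set ℝ := {s | ∀ v ∈ V, ⟪x, v⟫ ≠ s} with hU
  have hUo : IsOpen U := by
    have : U = ((fun v => ⟪x, v⟫) '' V)ᶜ := by
      ext s
      simp [hU]
    rw [this]
    exact (hVfin.image _).isClosed.isOpen_compl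
  have hTU : ∀ t ∈ T, -⟪x, t⟫ ∈ U := by
    intro t ht v hv
    rw [hT] at ht
    have := ht v hv
    rw [inner_add_right] at this
    exact fun h => this (by rw [h, neg_add_cancel])
  set J := connectedComponentIn U (-⟪x, t₀⟫) with hJ
  have hJU : J ⊆ U := connectedComponentIn_subset _ _
  have hcomp : ∀ t ∈ connectedComponentIn T t₀, -⟪x, t⟫ ∈ J := by
    intro t ht
    have hcont : ContinuousOn (fun t => -⟪x, t⟫) (connectedComponentIn T t₀) := by fun_prop
    refine (isPreconnected_connectedComponentIn.image _ hcont).subset_connectedComponentIn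
      ⟨t₀, mem_connectedComponentIn ht₀, rfl⟩ ?_ ⟨t, ht, rfl⟩
    rintro _ ⟨t', ht', rfl⟩
    exact hTU t' (connectedComponentIn_subset _ _ ht')
  obtain ⟨q, hq, hqs⟩ := exists_polynomial_hausdorffMeasure_slice ((↑) : V → EuclideanSpace ℝ (Fin d))
    hx hUo.connectedComponentIn isPreconnected_connectedComponentIn
    ⟨_, mem_connectedComponentIn (hTU t₀ ht₀)⟩ fun v hv => hJU hv v v.2 rfl
  rw [finrank_euclideanSpace_fin, ← hPV] at hqs
  rw [finrank_euclideanSpace_fin] at hq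
  refine ⟨Polynomial.aeval (∑ i, (-x i) • (MvPolynomial.X i : MvPolynomial (Fin d) ℝ)) q,
    (MvPolynomial.totalDegree_aeval_le q ?_).trans hq, fun t ht => ?_⟩
  · refine (MvPolynomial.totalDegree_finsetSum _ _).trans (Finset.sup_le fun i _ => ?_)
    exact (MvPolynomial.totalDegree_smul_le _ _).trans (MvPolynomial.totalDegree_X i).le
  · rw [image_add_right_inter_perp, IsometryEquiv.hausdorffMeasure_image, hqs _ (hcomp t ht),
      ← MvPolynomial.coe_aeval_eq_eval, RingHom.coe_coe, ← Polynomial.aeval_algHom_apply,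
      Polynomial.coe_aeval_eq_eval]
    congr 1
    simp [PiLp.inner_apply, mul_comm]
end
end

section
/- Let P ⊆ ℝ^d be a full-dimensional polytope. If the intersection body IP is convex, then the origin lies in the interior of P. Equivalently, if the origin lies outside P, or on the boundary of P (in particular in the relative interior of a facet, or on a face of dimension at most d − 2, or at a vertex), then IP is not convex. -/
open MeasureTheory
open scoped RealInnerProductSpace

noncomputable section

open Filter Topology

theorem perp_neg {d : ℕ} (x : EuclideanSpace ℝ (Fin d)) : perp (-x) = perp x := by
  ext y; simp [perp]

theorem perp_smul {d : ℕ} {c : ℝ} (hc : c ≠ 0) (x : EuclideanSpace ℝ (Fin d)) :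
    perp (c • x) = perp x := by
  ext y; simp [perp, real_inner_smul_left, hc]

theorem coe_orthogonal_span_singleton {d : ℕ} (x : EuclideanSpace ℝ (Fin d)) :
    ((ℝ ∙ x)ᗮ : Set (EuclideanSpace ℝ (Fin d))) = perp x := by
  ext y; simp [perp, Submodule.mem_orthogonal_singleton_iff_inner_right]

theorem finrank_orthogonal_span_singleton_eq {d : ℕ} {x : EuclideanSpace ℝ (Fin d)}
    (hx : x ≠ 0) : (Module.finrank ℝ (ℝ ∙ x)ᗮ : ℝ) = (d : ℝ) - 1 := by
  have h := Submodule.finrank_add_finrank_orthogonal (ℝ ∙ x)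
  rw [finrank_span_singleton hx, finrank_euclideanSpace_fin] at h
  have h' : (1 : ℝ) + Module.finrank ℝ (ℝ ∙ x)ᗮ = d := by exact_mod_cast h
  linarith

theorem sub_one_nonneg_of_ne_zero {d : ℕ} {x : EuclideanSpace ℝ (Fin d)} (hx : x ≠ 0) :
    0 ≤ (d : ℝ) - 1 := by
  rw [← finrank_orthogonal_span_singleton_eq hx]; positivity

/-- The measure of a section by `x^⊥` computed inside the subspace `x^⊥`. -/
theorem hausdorffMeasure_inter_perp {d : ℕ} {x : EuclideanSpace ℝ (Fin d)} (hx : x ≠ 0)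
    (S : Set (EuclideanSpace ℝ (Fin d))) :
    μH[(d : ℝ) - 1] (S ∩ perp x) =
      μH[(Module.finrank ℝ (ℝ ∙ x)ᗮ : ℝ)] (((↑) : (ℝ ∙ x)ᗮ → EuclideanSpace ℝ (Fin d)) ⁻¹' S) := by
  rw [finrank_orthogonal_span_singleton_eq hx,
    ← (isometry_subtype_coe (s := ((ℝ ∙ x)ᗮ : Set (EuclideanSpace ℝ (Fin d))))).hausdorffMeasure_image
      (Or.inl (sub_one_nonneg_of_ne_zero hx)), ← coe_orthogonal_span_singleton x]
  congr 1
  ext y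
  simp [and_comm]

theorem hausdorffMeasure_inter_perp_lt_top {d : ℕ} {x : EuclideanSpace ℝ (Fin d)} (hx : x ≠ 0)
    {S : Set (EuclideanSpace ℝ (Fin d))} (hS : Bornology.IsBounded S) :
    μH[(d : ℝ) - 1] (S ∩ perp x) < ⊤ := by
  rw [hausdorffMeasure_inter_perp hx]
  apply Bornology.IsBounded.measure_lt_top
  exact (AntilipschitzWith.subtype_coe
    ((ℝ ∙ x)ᗮ : Set (EuclideanSpace ℝ (Fin d)))).isBounded_preimage hS

theorem hausdorffMeasure_inter_perp_pos {d : ℕ} {x p : EuclideanSpace ℝ (Fin d)} (hx : x ≠ 0)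
    {S : Set (EuclideanSpace ℝ (Fin d))} (hp : p ∈ interior S) (hxp : ⟪x, p⟫ = 0) :
    0 < μH[(d : ℝ) - 1] (S ∩ perp x) := by
  refine lt_of_lt_of_le ?_ (measure_mono (Set.inter_subset_inter_left _ interior_subset))
  rw [hausdorffMeasure_inter_perp hx]
  refine (isOpen_interior.preimage continuous_subtype_val).measure_pos _ ?_
  exact ⟨⟨p, Submodule.mem_orthogonal_singleton_iff_inner_right.2 hxp⟩, hp⟩

theorem hausdorffMeasure_perp_inter_perp {d : ℕ} {u v w : EuclideanSpace ℝ (Fin d)} (hu : u ≠ 0)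
    (huw : ⟪u, w⟫ = 0) (hvw : ⟪v, w⟫ ≠ 0) : μH[(d : ℝ) - 1] (perp v ∩ perp u) = 0 := by
  rw [hausdorffMeasure_inter_perp hu]
  have h := Measure.addHaar_submodule μH[(Module.finrank ℝ (ℝ ∙ u)ᗮ : ℝ)]
    ((ℝ ∙ v)ᗮ.comap (ℝ ∙ u)ᗮ.subtype) ?_
  · rwa [Submodule.comap_coe, coe_orthogonal_span_singleton v] at h
  · intro h
    have : (⟨w, Submodule.mem_orthogonal_singleton_iff_inner_right.2 huw⟩ : (ℝ ∙ u)ᗮ) ∈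
        (ℝ ∙ v)ᗮ.comap (ℝ ∙ u)ᗮ.subtype := h ▸ Submodule.mem_top
    exact hvw (Submodule.mem_orthogonal_singleton_iff_inner_right.1 this)

theorem mem_ibody_iff {d : ℕ} {s : ℝ} {P : Set (EuclideanSpace ℝ (Fin d))}
    {x : EuclideanSpace ℝ (Fin d)} (hx : x ≠ 0) :
    x ∈ ibody s P ↔ ‖x‖ ≤ μH[s].real (P ∩ perp x) := by
  simp [ibody, radialFn, hx, Measure.real, one_le_div (norm_pos_iff.2 hx)]

theorem neg_mem_ibody {d : ℕ} {s : ℝ} {P : Set (EuclideanSpace ℝ (Fin d))}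
    {x : EuclideanSpace ℝ (Fin d)} (hx : x ∈ ibody s P) : -x ∈ ibody s P := by
  rcases eq_or_ne x 0 with rfl | h
  · simpa using hx
  · rw [mem_ibody_iff (neg_ne_zero.2 h), perp_neg, norm_neg]
    exact (mem_ibody_iff h).1 hx

theorem smul_mem_ibody {d : ℕ} {s c : ℝ} {P : Set (EuclideanSpace ℝ (Fin d))}
    {x : EuclideanSpace ℝ (Fin d)} (hc : 0 < c) (h : c * ‖x‖ ≤ μH[s].real (P ∩ perp x)) :
    c • x ∈ ibody s P := by
  rcases eq_or_ne x 0 with rfl | hx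
  · simp [ibody]
  · rwa [mem_ibody_iff (smul_ne_zero hc.ne' hx), perp_smul hc.ne', norm_smul, Real.norm_of_nonneg hc.le]

theorem exists_smul_mem_ibody {d : ℕ} {P : Set (EuclideanSpace ℝ (Fin d))}
    (hP : Bornology.IsBounded P) {x p : EuclideanSpace ℝ (Fin d)} (hx : x ≠ 0)
    (hp : p ∈ interior P) (hxp : ⟪x, p⟫ = 0) :
    ∃ c : ℝ, 0 < c ∧ c • x ∈ ibody ((d : ℝ) - 1) P := by
  have h : 0 < μH[(d : ℝ) - 1].real (P ∩ perp x) :=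
    ENNReal.toReal_pos (hausdorffMeasure_inter_perp_pos hx hp hxp).ne'
      (hausdorffMeasure_inter_perp_lt_top hx hP).ne
  have hx' := norm_pos_iff.2 hx
  refine ⟨_, div_pos h hx', smul_mem_ibody (div_pos h hx') ?_⟩
  rw [div_mul_cancel₀ _ hx'.ne']

/-- The orthogonal projection to `u^⊥`, for a unit vector `u`. -/
def projPerp {d : ℕ} (u y : EuclideanSpace ℝ (Fin d)) : EuclideanSpace ℝ (Fin d) :=
  y - ⟪u, y⟫ • u

theorem continuous_projPerp {d : ℕ} (u : EuclideanSpace ℝ (Fin d)) : Continuous (projPerp u) := by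
  unfold projPerp; fun_prop

theorem projPerp_mem_perp {d : ℕ} {u : EuclideanSpace ℝ (Fin d)} (hu : ‖u‖ = 1)
    (y : EuclideanSpace ℝ (Fin d)) : projPerp u y ∈ perp u := by
  simp [perp, projPerp, inner_sub_right, real_inner_smul_right, hu]

/-- A set whose secants make a small angle with `u^⊥` projects to `u^⊥` with little loss. -/
theorem hausdorffMeasure_le_projPerp {d : ℕ} {s η : ℝ} (hs : 0 ≤ s)
    {u : EuclideanSpace ℝ (Fin d)} (hu : ‖u‖ = 1) (hη : η < 1) {S : Set (EuclideanSpace ℝ (Fin d))}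
    (hS : ∀ y ∈ S, ∀ z ∈ S, |⟪u, y - z⟫| ≤ η * ‖y - z‖) (hfin : μH[s] (projPerp u '' S) ≠ ⊤) :
    μH[s].real S ≤ ((1 - η)⁻¹) ^ s * μH[s].real (projPerp u '' S) := by
  have key : ∀ y ∈ S, ∀ z ∈ S, ‖y - z‖ ≤ (1 - η)⁻¹ * ‖projPerp u y - projPerp u z‖ := by
    intro y hy z hz
    rw [inv_mul_eq_div, le_div_iff₀ (by linarith)]
    have h1 : y - z = (projPerp u y - projPerp u z) + ⟪u, y - z⟫ • u := by
      simp only [projPerp, inner_sub_right, sub_smul]; abel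
    have h2 : ‖y - z‖ ≤ ‖projPerp u y - projPerp u z‖ + |⟪u, y - z⟫| := by
      conv_lhs => rw [h1]
      refine (norm_add_le _ _).trans ?_
      rw [norm_smul, hu, mul_one, Real.norm_eq_abs]
    linarith [hS y hy z hz]
  have hK : 0 ≤ (1 - η)⁻¹ := inv_nonneg.2 (by linarith)
  have hinj : Set.InjOn (projPerp u) S := by
    intro y hy z hz h
    have := key y hy z hz
    rw [h, sub_self, norm_zero, mul_zero] at this
    exact sub_eq_zero.1 (norm_le_zero_iff.1 this)
  have hL : LipschitzOnWith (1 - η)⁻¹.toNNReal (Function.invFunOn (projPerp u) S)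
      (projPerp u '' S) := by
    refine LipschitzOnWith.of_dist_le_mul ?_
    rintro _ ⟨y, hy, rfl⟩ _ ⟨z, hz, rfl⟩
    rw [hinj.leftInvOn_invFunOn hy, hinj.leftInvOn_invFunOn hz, Real.coe_toNNReal _ hK,
      dist_eq_norm, dist_eq_norm]
    exact key y hy z hz
  have hle := hL.hausdorffMeasure_image_le hs
  rw [hinj.leftInvOn_invFunOn.image_image] at hle
  have := ENNReal.toReal_mono (ENNReal.mul_ne_top (by simp [hs]) hfin) hle
  rwa [ENNReal.toReal_mul, ← ENNReal.toReal_rpow, ENNReal.coe_toReal, Real.coe_toNNReal _ hK] at this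

/-- The part of `P` of height at most `t` over `u^⊥`, projected to `u^⊥`. -/
def slabProj {d : ℕ} (P : Set (EuclideanSpace ℝ (Fin d))) (u : EuclideanSpace ℝ (Fin d)) (t : ℝ) :
    Set (EuclideanSpace ℝ (Fin d)) :=
  projPerp u '' (P ∩ {y | ⟪u, y⟫ ≤ t})

section Slab

variable {d : ℕ} {P : Set (EuclideanSpace ℝ (Fin d))} {u : EuclideanSpace ℝ (Fin d)}

theorem isCompact_slabProj (hP : IsCompact P) (t : ℝ) : IsCompact (slabProj P u t) :=
  (hP.inter_right (isClosed_le (by fun_prop) continuous_const)).image (continuous_projPerp u)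

theorem hausdorffMeasure_ne_top_of_subset_slabProj (hP : IsCompact P) (hu : ‖u‖ = 1) {t : ℝ}
    {S : Set (EuclideanSpace ℝ (Fin d))} (hS : S ⊆ slabProj P u t) :
    μH[(d : ℝ) - 1] S ≠ ⊤ := by
  have hu0 : u ≠ 0 := norm_ne_zero_iff.1 (by rw [hu]; norm_num)
  refine ne_top_of_le_ne_top (hausdorffMeasure_inter_perp_lt_top hu0
    (isCompact_slabProj (u := u) hP t).isBounded).ne (measure_mono (Set.subset_inter hS ?_))
  intro z hz
  obtain ⟨y, -, rfl⟩ := hS hz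
  exact projPerp_mem_perp hu y

/-- The projected slabs over a supporting hyperplane shrink to the section by that hyperplane. -/
theorem tendsto_hausdorffMeasure_slabProj (hP : IsCompact P) (hu : ‖u‖ = 1)
    (hpos : ∀ y ∈ P, 0 ≤ ⟪u, y⟫) :
    Tendsto (fun n : ℕ => μH[(d : ℝ) - 1].real (slabProj P u (1 / ((n : ℝ) + 1)))) atTop
      (𝓝 (μH[(d : ℝ) - 1].real (P ∩ perp u))) := by
  have hanti : Antitone fun n : ℕ => slabProj P u (1 / ((n : ℝ) + 1)) := by
    intro m n hmn
    refine Set.image_mono fun y hy => ⟨hy.1, le_trans (b := 1 / ((n : ℝ) + 1)) hy.2 ?_⟩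
    exact one_div_le_one_div_of_le (by positivity) (by gcongr)
  have hInter : ⋂ n : ℕ, slabProj P u (1 / ((n : ℝ) + 1)) = P ∩ perp u := by
    ext z
    simp only [Set.mem_iInter]
    constructor
    · intro hz
      choose y hy hyz using hz
      have h0 : Tendsto (fun n => ⟪u, y n⟫) atTop (𝓝 0) :=
        squeeze_zero (fun n => hpos _ (hy n).1) (fun n => (hy n).2)
          tendsto_one_div_add_atTop_nhds_zero_nat
      have hlim : Tendsto y atTop (𝓝 z) := by
        have : y = fun n => z + ⟪u, y n⟫ • u := by
          funext n
          conv_rhs => rw [← hyz n]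
          simp [projPerp]
        rw [this]
        simpa using (tendsto_const_nhds (x := z)).add (h0.smul_const u)
      refine ⟨hP.isClosed.mem_of_tendsto hlim (Eventually.of_forall fun n => (hy n).1), ?_⟩
      rw [← hyz 0]
      exact projPerp_mem_perp hu _
    · rintro ⟨hzP, hz : ⟪u, z⟫ = 0⟩ n
      refine ⟨z, ⟨hzP, ?_⟩, by simp [projPerp, hz]⟩
      change ⟪u, z⟫ ≤ _
      rw [hz]
      positivity
  have h := tendsto_measure_iInter_atTop (μ := μH[(d : ℝ) - 1])
    (fun n : ℕ => (isCompact_slabProj (u := u) hP (1 / ((n : ℝ) + 1))).measurableSet.nullMeasurableSet)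
    hanti ⟨0, hausdorffMeasure_ne_top_of_subset_slabProj hP hu subset_rfl⟩
  rw [hInter] at h
  have hfin : μH[(d : ℝ) - 1] (P ∩ perp u) ≠ ⊤ := by
    rw [← hInter]
    exact hausdorffMeasure_ne_top_of_subset_slabProj hP hu (Set.iInter_subset _ 0)
  exact (ENNReal.tendsto_toReal hfin).comp h

theorem projPerp_section_subset_slabProj {x : EuclideanSpace ℝ (Fin d)} {η M t : ℝ}
    (hM : ∀ y ∈ P, ‖y‖ ≤ M) (hη : 0 ≤ η) (ht : η * M ≤ t)
    (hx : ∀ y ∈ perp x, |⟪u, y⟫| ≤ η * ‖y‖) :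
    projPerp u '' (P ∩ perp x) ⊆ slabProj P u t := by
  refine Set.image_mono fun y hy => ⟨hy.1, ?_⟩
  exact (le_abs_self _).trans ((hx y hy.2).trans
    ((mul_le_mul_of_nonneg_left (hM y hy.1) hη).trans ht))

/-- The two sections of `P` by hyperplanes tilted in opposite directions from a supporting
hyperplane have essentially disjoint projections, so together they are bounded by the slab. -/
theorem section_add_section_le {v w : EuclideanSpace ℝ (Fin d)} (hP : IsCompact P) (hu : ‖u‖ = 1)
    (hpos : ∀ y ∈ P, 0 ≤ ⟪u, y⟫) (huw : ⟪u, w⟫ = 0) (hvw : ⟪v, w⟫ ≠ 0)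
    {M t a r : ℝ} (hM : ∀ y ∈ P, ‖y‖ ≤ M) (ha : 0 < a) (hr : 0 < r)
    (hra : r * ‖v‖ / a < 1) (ht : r * ‖v‖ / a * M ≤ t) :
    μH[(d : ℝ) - 1].real (P ∩ perp (a • u + r • v)) +
      μH[(d : ℝ) - 1].real (P ∩ perp (a • u - r • v)) ≤
    ((1 - r * ‖v‖ / a)⁻¹) ^ ((d : ℝ) - 1) * μH[(d : ℝ) - 1].real (slabProj P u t) := by
  have hu0 : u ≠ 0 := norm_ne_zero_iff.1 (by rw [hu]; norm_num)
  have hs := sub_one_nonneg_of_ne_zero hu0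
  have hη : 0 ≤ r * ‖v‖ / a := by positivity
  have hrv : r * |⟪v, u⟫| < a := by
    rw [div_lt_one ha] at hra
    have : |⟪v, u⟫| ≤ ‖v‖ := by simpa [hu] using abs_real_inner_le_norm v u
    nlinarith
  obtain ⟨hrv1, hrv2⟩ : -a < r * ⟪v, u⟫ ∧ r * ⟪v, u⟫ < a := by
    rwa [← abs_lt, abs_mul, abs_of_pos hr]
  have tilt : ∀ e : ℝ, |e| = r → ∀ y ∈ perp (a • u + e • v), |⟪u, y⟫| ≤ r * ‖v‖ / a * ‖y‖ := by
    intro e he y hy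
    have h1 : a * ⟪u, y⟫ + e * ⟪v, y⟫ = 0 := by
      simpa [perp, inner_add_left, real_inner_smul_left] using hy
    have h2 : a * |⟪u, y⟫| = r * |⟪v, y⟫| := by
      have h := congrArg abs (eq_neg_of_add_eq_zero_left h1)
      rwa [abs_neg, abs_mul, abs_mul, abs_of_pos ha, he] at h
    rw [div_mul_eq_mul_div, le_div_iff₀ ha, mul_comm, h2, mul_assoc]
    exact mul_le_mul_of_nonneg_left (abs_real_inner_le_norm v y) hr.le
  have bound : ∀ e : ℝ, |e| = r →
      projPerp u '' (P ∩ perp (a • u + e • v)) ⊆ slabProj P u t ∧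
      μH[(d : ℝ) - 1].real (P ∩ perp (a • u + e • v)) ≤ ((1 - r * ‖v‖ / a)⁻¹) ^ ((d : ℝ) - 1) *
        μH[(d : ℝ) - 1].real (projPerp u '' (P ∩ perp (a • u + e • v))) := by
    intro e he
    have hsub := projPerp_section_subset_slabProj hM hη ht (tilt e he)
    refine ⟨hsub, hausdorffMeasure_le_projPerp hs hu hra (fun y hy z hz => tilt e he _ ?_)
      (hausdorffMeasure_ne_top_of_subset_slabProj hP hu hsub)⟩
    rw [← coe_orthogonal_span_singleton] at hy hz ⊢
    exact sub_mem hy.2 hz.2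
  obtain ⟨hsub₁, hle₁⟩ := bound r (abs_of_pos hr)
  obtain ⟨hsub₂, hle₂⟩ := bound (-r) (by rw [abs_neg, abs_of_pos hr])
  simp only [neg_smul, ← sub_eq_add_neg] at hsub₂ hle₂
  set T₁ := projPerp u '' (P ∩ perp (a • u + r • v))
  set T₂ := projPerp u '' (P ∩ perp (a • u - r • v))
  have hinter : T₁ ∩ T₂ ⊆ perp v ∩ perp u := by
    rintro z ⟨⟨y, ⟨hyP, hy⟩, rfl⟩, ⟨y', ⟨hyP', hy'⟩, hyy⟩⟩
    refine ⟨?_, projPerp_mem_perp hu y⟩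
    have h1 : a * ⟪u, y⟫ + r * ⟪v, y⟫ = 0 := by
      simpa [perp, inner_add_left, real_inner_smul_left] using hy
    have h2 : a * ⟪u, y'⟫ - r * ⟪v, y'⟫ = 0 := by
      simpa [perp, inner_sub_left, real_inner_smul_left] using hy'
    have h3 : ⟪v, projPerp u y⟫ = ⟪v, y⟫ - ⟪u, y⟫ * ⟪v, u⟫ := by
      simp [projPerp, inner_sub_right, real_inner_smul_right]
    have h4 : ⟪v, projPerp u y⟫ = ⟪v, y'⟫ - ⟪u, y'⟫ * ⟪v, u⟫ := by
      rw [← hyy]; simp [projPerp, inner_sub_right, real_inner_smul_right]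
    have h5 : r * ⟪v, projPerp u y⟫ ≤ 0 := by
      rw [h3]; nlinarith [hpos y hyP]
    have h6 : 0 ≤ r * ⟪v, projPerp u y⟫ := by
      rw [h4]; nlinarith [hpos y' hyP']
    have h7 := le_antisymm h5 h6
    simpa [perp, hr.ne'] using h7
  have hperp : ∀ x : EuclideanSpace ℝ (Fin d), IsClosed (perp x) := fun x =>
    isClosed_eq (by fun_prop) continuous_const
  have hunion := measureReal_union_add_inter (μ := μH[(d : ℝ) - 1]) (s := T₁) (t := T₂)
    ((hP.inter_right (hperp _)).image (continuous_projPerp u)).measurableSet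
    (hausdorffMeasure_ne_top_of_subset_slabProj hP hu hsub₁)
    (hausdorffMeasure_ne_top_of_subset_slabProj hP hu hsub₂)
  have hzero : μH[(d : ℝ) - 1].real (T₁ ∩ T₂) = 0 := by
    rw [Measure.real, measure_mono_null hinter (hausdorffMeasure_perp_inter_perp hu0 huw hvw)]
    rfl
  have hmono : μH[(d : ℝ) - 1].real (T₁ ∪ T₂) ≤ μH[(d : ℝ) - 1].real (slabProj P u t) :=
    measureReal_mono (Set.union_subset hsub₁ hsub₂)
      (hausdorffMeasure_ne_top_of_subset_slabProj hP hu subset_rfl)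
  rw [hzero, add_zero] at hunion
  calc _ ≤ ((1 - r * ‖v‖ / a)⁻¹) ^ ((d : ℝ) - 1) * (μH[(d : ℝ) - 1].real T₁ +
          μH[(d : ℝ) - 1].real T₂) := by rw [mul_add]; exact add_le_add hle₁ hle₂
    _ ≤ _ := by
      rw [← hunion]
      exact mul_le_mul_of_nonneg_left hmono (Real.rpow_nonneg (inv_nonneg.2 (by linarith)) _)

end Slab

/-- A set with nonempty interior that is convex and does not contain the origin in its interior
lies on one side of a hyperplane through the origin. -/
theorem exists_unit_inner_nonneg {d : ℕ} {P : Set (EuclideanSpace ℝ (Fin d))} (hP : Convex ℝ P)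
    (hint : (interior P).Nonempty) (h0 : (0 : EuclideanSpace ℝ (Fin d)) ∉ interior P) :
    ∃ u : EuclideanSpace ℝ (Fin d), ‖u‖ = 1 ∧ (∀ y ∈ P, 0 ≤ ⟪u, y⟫) ∧
      ∀ y ∈ interior P, 0 < ⟪u, y⟫ := by
  obtain ⟨f, hf⟩ := geometric_hahn_banach_open_point hP.interior isOpen_interior h0
  set n := (InnerProductSpace.toDual ℝ (EuclideanSpace ℝ (Fin d))).symm (-f) with hn
  have hfn : ∀ y, ⟪n, y⟫ = -f y := fun y => by
    rw [hn, InnerProductSpace.toDual_symm_apply]; rfl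
  have hnpos : ∀ y ∈ interior P, 0 < ⟪n, y⟫ := fun y hy => by
    have := hf y hy
    rw [map_zero] at this
    rw [hfn]; linarith
  have hn0 : n ≠ 0 := by
    rintro h
    obtain ⟨p, hp⟩ := hint
    have := hnpos p hp
    simp [h] at this
  have hnn := norm_pos_iff.2 hn0
  refine ⟨‖n‖⁻¹ • n, ?_, fun y hy => ?_, fun y hy => ?_⟩
  · rw [norm_smul, norm_inv, norm_norm, inv_mul_cancel₀ hnn.ne']
  · rw [real_inner_smul_left]
    refine mul_nonneg (inv_nonneg.2 hnn.le) ?_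
    have hcl : y ∈ closure (interior P) := by
      rw [hP.closure_interior_eq_closure_of_nonempty_interior hint]; exact subset_closure hy
    have hclosed : IsClosed {y : EuclideanSpace ℝ (Fin d) | 0 ≤ ⟪n, y⟫} :=
      isClosed_le continuous_const (by fun_prop)
    exact closure_minimal (fun z hz => (hnpos z hz).le) hclosed hcl
  · rw [real_inner_smul_left]
    exact mul_pos (inv_pos.2 hnn) (hnpos y hy)

theorem exists_ne_zero_inner_eq_zero {d : ℕ} (hd : 2 ≤ d) {u : EuclideanSpace ℝ (Fin d)}
    (hu : u ≠ 0) : ∃ w : EuclideanSpace ℝ (Fin d), w ≠ 0 ∧ ⟪u, w⟫ = 0 := by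
  have h := finrank_orthogonal_span_singleton_eq hu
  have hd' : (2 : ℝ) ≤ d := by exact_mod_cast hd
  have hpos : 0 < Module.finrank ℝ (ℝ ∙ u)ᗮ := by
    have : (0 : ℝ) < Module.finrank ℝ (ℝ ∙ u)ᗮ := by linarith
    exact_mod_cast this
  have := Module.finrank_pos_iff.1 hpos
  obtain ⟨⟨w, hw⟩, hw0⟩ := exists_ne (0 : (ℝ ∙ u)ᗮ)
  exact ⟨w, fun h => hw0 (Subtype.ext h), Submodule.mem_orthogonal_singleton_iff_inner_right.1 hw⟩

/-- If the intersection body of a convex body is convex, the origin is an interior point. -/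
theorem zero_mem_interior_of_convex_ibody {d : ℕ} (hd : 2 ≤ d)
    {P : Set (EuclideanSpace ℝ (Fin d))} (hP : Convex ℝ P) (hcomp : IsCompact P)
    (hint : (interior P).Nonempty) (hconv : Convex ℝ (ibody ((d : ℝ) - 1) P)) :
    (0 : EuclideanSpace ℝ (Fin d)) ∈ interior P := by
  by_contra h0
  obtain ⟨u, hu, hpos, hposint⟩ := exists_unit_inner_nonneg hP hint h0
  have hu0 : u ≠ 0 := norm_ne_zero_iff.1 (by rw [hu]; norm_num)
  obtain ⟨w, hw0, huw⟩ := exists_ne_zero_inner_eq_zero hd hu0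
  have hwu : ⟪w, u⟫ = 0 := by rw [real_inner_comm]; exact huw
  have hww : 0 < ⟪w, w⟫ := real_inner_self_pos.2 hw0
  obtain ⟨p, hp⟩ := hint
  -- for `q` interior, the vector of `span {u, w}` orthogonal to `q`
  have dir : ∀ q ∈ interior P, ∃ c : ℝ, 0 < c ∧
      c • (⟪w, q⟫ • u - ⟪u, q⟫ • w) ∈ ibody ((d : ℝ) - 1) P := by
    intro q hq
    refine exists_smul_mem_ibody hcomp.isBounded ?_ hq ?_
    · intro h
      have h' : ⟪⟪w, q⟫ • u - ⟪u, q⟫ • w, w⟫ = 0 := by rw [h, inner_zero_left]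
      simp only [inner_sub_left, real_inner_smul_left, huw, mul_zero, zero_sub, neg_eq_zero,
        mul_eq_zero, hww.ne', or_false] at h'
      exact (hposint q hq).ne' h'
    · simp only [inner_sub_left, real_inner_smul_left]; ring
  obtain ⟨t, ht, hq⟩ : ∃ t : ℝ, 0 < t ∧ p + t • w ∈ interior P := by
    have hc : Tendsto (fun t : ℝ => p + t • w) (𝓝[>] 0) (𝓝 p) := by
      have : Continuous fun t : ℝ => p + t • w := by fun_prop
      simpa using (this.tendsto 0).mono_left nhdsWithin_le_nhds
    obtain ⟨t, h1, h2⟩ :=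
      ((hc.eventually (isOpen_interior.mem_nhds hp)).and self_mem_nhdsWithin).exists
    exact ⟨t, h2, h1⟩
  obtain ⟨c₁, hc₁, hmem₁⟩ := dir p hp
  obtain ⟨c₂, hc₂, hmem₂⟩ := dir _ hq
  have hA : 0 < μH[(d : ℝ) - 1].real (P ∩ perp u) := by
    have hk : 0 < c₁ * c₂ / (c₁ + c₂) * (t * ⟪w, w⟫) := by positivity
    have hmem := hconv (neg_mem_ibody hmem₁) hmem₂ (a := c₂ / (c₁ + c₂)) (b := c₁ / (c₁ + c₂))
      (by positivity) (by positivity) (by field_simp; ring)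
    have heq : (c₂ / (c₁ + c₂)) • -(c₁ • (⟪w, p⟫ • u - ⟪u, p⟫ • w)) +
        (c₁ / (c₁ + c₂)) • c₂ • (⟪w, p + t • w⟫ • u - ⟪u, p + t • w⟫ • w) =
        (c₁ * c₂ / (c₁ + c₂) * (t * ⟪w, w⟫)) • u := by
      simp only [inner_add_right, real_inner_smul_right, huw, mul_zero, add_zero]
      module
    rw [heq, mem_ibody_iff (smul_ne_zero hk.ne' hu0), perp_smul hk.ne', norm_smul, hu, mul_one,
      Real.norm_of_nonneg hk.le] at hmem
    exact hk.trans_le hmem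
  set A := μH[(d : ℝ) - 1].real (P ∩ perp u) with hAdef
  set v := c₁ • (⟪w, p⟫ • u - ⟪u, p⟫ • w) with hv
  have hvw : ⟪v, w⟫ ≠ 0 := by
    rw [hv]
    simp only [real_inner_smul_left, inner_sub_left, huw, mul_zero, zero_sub]
    have := hposint p hp
    exact mul_ne_zero hc₁.ne' (neg_ne_zero.2 (by positivity))
  have hAu : A • u ∈ ibody ((d : ℝ) - 1) P := smul_mem_ibody hA (by rw [hu, mul_one])
  obtain ⟨M, hM⟩ := hcomp.isBounded.exists_norm_le
  have key : ∀ n : ℕ, 2 * A ≤ μH[(d : ℝ) - 1].real (slabProj P u (1 / ((n : ℝ) + 1))) := by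
    intro n
    set m := μH[(d : ℝ) - 1].real (slabProj P u (1 / ((n : ℝ) + 1)))
    have hη : ContinuousAt (fun r : ℝ => r * ‖v‖ / ((1 - r) * A)) 0 :=
      ContinuousAt.div (by fun_prop) (by fun_prop) (by simpa using hA.ne')
    have hη0 : Tendsto (fun r : ℝ => r * ‖v‖ / ((1 - r) * A)) (𝓝[>] 0) (𝓝 0) := by
      simpa [ContinuousAt] using hη.mono_left nhdsWithin_le_nhds
    have hηM : Tendsto (fun r : ℝ => r * ‖v‖ / ((1 - r) * A) * M) (𝓝[>] 0) (𝓝 0) := by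
      simpa using hη0.mul_const M
    have hlhs : Tendsto (fun r : ℝ => 2 * ((1 - r) * A)) (𝓝[>] 0) (𝓝 (2 * A)) := by
      have : Continuous fun r : ℝ => 2 * ((1 - r) * A) := by fun_prop
      simpa using (this.tendsto 0).mono_left nhdsWithin_le_nhds
    have hrhs : Tendsto (fun r : ℝ => ((1 - r * ‖v‖ / ((1 - r) * A))⁻¹) ^ ((d : ℝ) - 1) * m)
        (𝓝[>] 0) (𝓝 m) := by
      have h1 : Tendsto (fun r : ℝ => (1 - r * ‖v‖ / ((1 - r) * A))⁻¹) (𝓝[>] 0) (𝓝 1) := by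
        simpa using (hη0.const_sub 1).inv₀ (by norm_num)
      simpa using (h1.rpow_const (p := (d : ℝ) - 1) (Or.inl one_ne_zero)).mul_const m
    refine le_of_tendsto_of_tendsto hlhs hrhs ?_
    have hn : (0 : ℝ) < 1 / ((n : ℝ) + 1) := by positivity
    filter_upwards [hη0.eventually_lt_const one_pos, hηM.eventually_lt_const hn,
      Ioo_mem_nhdsGT (zero_lt_one (α := ℝ))] with r hr1 hr2 ⟨hr3, hr4⟩
    have ha : 0 < (1 - r) * A := mul_pos (by linarith) hA
    have hle := section_add_section_le hcomp hu hpos huw hvw hM ha hr3 hr1 hr2.le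
    have hne : ∀ e : ℝ, e ≠ 0 → ((1 - r) * A) • u + e • v ≠ 0 := by
      intro e he h
      have h' : ⟪((1 - r) * A) • u + e • v, w⟫ = 0 := by rw [h, inner_zero_left]
      simp [inner_add_left, real_inner_smul_left, huw, he, hvw] at h'
    have h₁ : ((1 - r) * A) • u + r • v ∈ ibody ((d : ℝ) - 1) P := by
      rw [mul_smul]; exact hconv hAu hmem₁ (by linarith) hr3.le (by ring)
    have h₂ : ((1 - r) * A) • u + (-r) • v ∈ ibody ((d : ℝ) - 1) P := by
      rw [mul_smul, neg_smul, ← smul_neg]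
      exact hconv hAu (neg_mem_ibody hmem₁) (by linarith) hr3.le (by ring)
    rw [mem_ibody_iff (hne r hr3.ne')] at h₁
    rw [mem_ibody_iff (hne (-r) (neg_ne_zero.2 hr3.ne'))] at h₂
    rw [neg_smul, ← sub_eq_add_neg] at h₂
    have hsum : 2 * ((1 - r) * A) ≤ ‖((1 - r) * A) • u + r • v‖ + ‖((1 - r) * A) • u - r • v‖ := by
      refine le_trans (le_of_eq ?_) (norm_add_le _ _)
      rw [add_add_sub_cancel, ← two_smul ℝ, norm_smul, norm_smul, hu, Real.norm_of_nonneg ha.le]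
      norm_num
    linarith
  linarith [ge_of_tendsto' (tendsto_hausdorffMeasure_slabProj hcomp hu hpos) key]

/-- Let `P ⊆ ℝ^d` (`d ≥ 2`) be a full-dimensional polytope. If the
intersection body `IP` is convex, then the origin lies in the interior of `P`. -/
theorem statement_10 (d : ℕ) (hd : 2 ≤ d) (P : Set (EuclideanSpace ℝ (Fin d)))
    (hpoly : IsPolytope P) (hfull : (interior P).Nonempty)
    (hconv : Convex ℝ (ibody ((d : ℝ) - 1) P)) :
    (0 : EuclideanSpace ℝ (Fin d)) ∈ interior P := by
  obtain ⟨S, rfl⟩ := hpoly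
  exact zero_mem_interior_of_convex_ibody hd (convex_convexHull ℝ _)
    (S.finite_toSet.isCompact_convexHull ℝ) hfull hconv
end
end

section
/- Let P ⊆ ℝ^d be a full-dimensional polytope such that the origin lies in the relative interior of a facet of P. Then the radial function ρ_IP : ℝ^d \ {0} → ℝ, ρ_IP(x) = vol_{d−1}(P ∩ x^⊥)/‖x‖, is not continuous on ℝ^d \ {0}. -/
open MeasureTheory
open scoped RealInnerProductSpace

noncomputable section

section TiltedSections

open Set Filter Topology
open scoped NNReal ENNReal

variable {E : Type*} [NormedAddCommGroup E] [InnerProductSpace ℝ E]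

/-- The parametrization of the hyperplane `(u - t • w)^⊥` by `u^⊥`, for `u` a unit vector
orthogonal to `w`. -/
def tilt (u w : E) (t : ℝ) (h : (ℝ ∙ u)ᗮ) : E := (h : E) + (t * ⟪w, (h : E)⟫) • u

lemma inner_coe_orthogonal_singleton (u : E) (h : (ℝ ∙ u)ᗮ) : ⟪u, (h : E)⟫ = 0 :=
  Submodule.mem_orthogonal_singleton_iff_inner_right.1 h.2

lemma inner_tilt {u : E} (hu : ‖u‖ = 1) (w : E) (t : ℝ) (h : (ℝ ∙ u)ᗮ) :
    ⟪u, tilt u w t h⟫ = t * ⟪w, (h : E)⟫ := by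
  simp [tilt, inner_add_right, inner_smul_right, inner_coe_orthogonal_singleton, hu]

lemma norm_le_norm_tilt (u w : E) (t : ℝ) (h : (ℝ ∙ u)ᗮ) : ‖h‖ ≤ ‖tilt u w t h‖ := by
  have key : ⟪(h : E), (t * ⟪w, (h : E)⟫) • u⟫ = 0 := by
    rw [inner_smul_right, real_inner_comm u, inner_coe_orthogonal_singleton, mul_zero]
  have := norm_add_sq_eq_norm_sq_add_norm_sq_real key
  change ‖(h : E)‖ ≤ ‖(h : E) + (t * ⟪w, (h : E)⟫) • u‖
  exact abs_le_of_sq_le_sq' (by nlinarith [mul_self_nonneg ‖(t * ⟪w, (h : E)⟫) • u‖])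
    (norm_nonneg _) |>.2

lemma continuous_tilt (u w : E) (t : ℝ) : Continuous (tilt u w t) := by
  unfold tilt; fun_prop

lemma lipschitzWith_tilt {u w : E} (hu : ‖u‖ = 1) (hw : ‖w‖ = 1) (t : ℝ) :
    LipschitzWith (1 + ‖t‖₊) (tilt u w t) := by
  refine LipschitzWith.of_dist_le_mul fun x y => ?_
  have e : tilt u w t x - tilt u w t y
      = ((x - y : (ℝ ∙ u)ᗮ) : E) + (t * ⟪w, ((x - y : (ℝ ∙ u)ᗮ) : E)⟫) • u := by
    simp only [tilt, Submodule.coe_sub, inner_sub_right, mul_sub, sub_smul]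
    abel
  have h1 : |⟪w, ((x - y : (ℝ ∙ u)ᗮ) : E)⟫| ≤ ‖x - y‖ := by
    simpa [hw] using abs_real_inner_le_norm w ((x - y : (ℝ ∙ u)ᗮ) : E)
  rw [dist_eq_norm, dist_eq_norm, e]
  refine (norm_add_le _ _).trans ?_
  rw [norm_smul, hu, mul_one, norm_mul, NNReal.coe_add, NNReal.coe_one, coe_nnnorm,
    add_mul, one_mul]
  exact add_le_add le_rfl (mul_le_mul_of_nonneg_left h1 (norm_nonneg t))

variable [MeasurableSpace E] [BorelSpace E]

lemma hausdorffMeasure_section_le {u w : E} (hu : ‖u‖ = 1) (hw : ‖w‖ = 1) (huw : ⟪u, w⟫ = 0)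
    {s : ℝ} (hs : 0 ≤ s) (P : Set E) (t : ℝ) :
    μH[s] (P ∩ {y | ⟪u - t • w, y⟫ = 0}) ≤
      ((1 + ‖t‖₊ : ℝ≥0) : ℝ≥0∞) ^ s * μH[s] (tilt u w t ⁻¹' P) := by
  refine (measure_mono ?_).trans ((lipschitzWith_tilt hu hw t).hausdorffMeasure_image_le hs _)
  rintro y ⟨hyP, hy⟩
  have hy' : ⟪u, y⟫ = t * ⟪w, y⟫ := by
    simpa [inner_sub_left, inner_smul_left, sub_eq_zero] using hy
  have hmem : y - ⟪u, y⟫ • u ∈ (ℝ ∙ u)ᗮ := by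
    rw [Submodule.mem_orthogonal_singleton_iff_inner_right]
    simp [inner_sub_right, inner_smul_right, hu]
  have htilt : tilt u w t ⟨_, hmem⟩ = y := by
    simp [tilt, inner_sub_right, inner_smul_right, real_inner_comm u w, huw, ← hy']
  exact ⟨⟨_, hmem⟩, by simpa [mem_preimage, htilt] using hyP, htilt⟩

lemma hausdorffMeasure_tilt_zero_le (u w : E) {s : ℝ} (hs : 0 ≤ s) (P : Set E) :
    μH[s] (tilt u w 0 ⁻¹' P) ≤ μH[s] (P ∩ {y | ⟪u, y⟫ = 0}) := by
  rw [← (isometry_subtype_coe (s := ((ℝ ∙ u)ᗮ : Set E))).hausdorffMeasure_image (Or.inl hs)]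
  refine measure_mono ?_
  rintro _ ⟨h, hh, rfl⟩
  exact ⟨by simpa [tilt] using hh, inner_coe_orthogonal_singleton u h⟩

variable [FiniteDimensional ℝ E]

lemma measure_tilt_add_measure_tilt_neg_le {u w : E} (hu : ‖u‖ = 1) (hw : w ≠ 0)
    (huw : ⟪u, w⟫ = 0) {P : Set E} (hP : IsClosed P) (hpos : ∀ y ∈ P, 0 ≤ ⟪u, y⟫)
    (μ : Measure (ℝ ∙ u)ᗮ) [μ.IsAddHaarMeasure] {t : ℝ} (ht : t ≠ 0) :
    μ (tilt u w t ⁻¹' P) + μ (tilt u w (-t) ⁻¹' P) ≤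
      μ (tilt u w t ⁻¹' P ∪ tilt u w (-t) ⁻¹' P ∪ tilt u w 0 ⁻¹' P) := by
  let L : Submodule ℝ (ℝ ∙ u)ᗮ := LinearMap.ker ((innerₛₗ ℝ w).comp (ℝ ∙ u)ᗮ.subtype)
  have hL : L ≠ ⊤ := by
    intro h
    have : (⟨w, Submodule.mem_orthogonal_singleton_iff_inner_right.2 huw⟩ : (ℝ ∙ u)ᗮ) ∈ L :=
      h ▸ Submodule.mem_top
    exact hw (by simpa [L] using this)
  have hd : AEDisjoint μ (tilt u w t ⁻¹' P) (tilt u w (-t) ⁻¹' P) := by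
    refine measure_mono_null ?_ (Measure.addHaar_submodule μ L hL)
    rintro h ⟨h1, h2⟩
    have h1 := hpos _ h1
    have h2 := hpos _ h2
    rw [inner_tilt hu] at h1 h2
    have : t * ⟪w, (h : E)⟫ = 0 := by linarith
    simpa [L, ht] using this
  rw [← measure_union₀ (hP.preimage (continuous_tilt u w _)).nullMeasurableSet hd]
  exact measure_mono subset_union_left

lemma tendsto_measure_tilt_union (u w : E) {P : Set E} (hP : IsCompact P)
    (μ : Measure (ℝ ∙ u)ᗮ) [μ.IsAddHaarMeasure] :
    Tendsto (fun t : ℝ =>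
      μ (tilt u w t ⁻¹' P ∪ tilt u w (-t) ⁻¹' P ∪ tilt u w 0 ⁻¹' P)) (𝓝[≠] 0)
      (𝓝 (μ (tilt u w 0 ⁻¹' P))) := by
  obtain ⟨R, hR⟩ := hP.isBounded.subset_closedBall 0
  have hsub : ∀ t, tilt u w t ⁻¹' P ⊆ Metric.closedBall 0 R := fun t h hh => by
    have := hR hh
    rw [mem_closedBall_zero_iff] at this ⊢
    exact (norm_le_norm_tilt u w t h).trans this
  have hmeas : ∀ t, MeasurableSet (tilt u w t ⁻¹' P) := fun t =>
    (hP.isClosed.preimage (continuous_tilt u w t)).measurableSet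
  refine tendsto_measure_of_tendsto_indicator _
    (fun t => ((hmeas t).union (hmeas _)).union (hmeas 0))
    (Metric.isClosed_closedBall (x := 0) (ε := R)).measurableSet
    (isCompact_closedBall _ _).measure_lt_top.ne
    (Eventually.of_forall fun t => union_subset (union_subset (hsub _) (hsub _)) (hsub _))
    fun h => ?_
  by_cases hh : tilt u w 0 h ∈ P
  · exact Eventually.of_forall fun t => by simp [hh]
  have hc : Continuous fun t => tilt u w t h := by unfold tilt; fun_prop
  have h1 : ∀ᶠ t in 𝓝 (0 : ℝ), tilt u w t h ∈ Pᶜ :=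
    hc.continuousAt.eventually (hP.isClosed.isOpen_compl.mem_nhds hh)
  have h2 : ∀ᶠ t in 𝓝 (0 : ℝ), tilt u w (-t) h ∈ Pᶜ :=
    (hc.comp continuous_neg).continuousAt.eventually
      (hP.isClosed.isOpen_compl.mem_nhds (by simpa using hh))
  filter_upwards [nhdsWithin_le_nhds h1, nhdsWithin_le_nhds h2] with t ht1 ht2
  simp_all

end TiltedSections

section Facets

open Set Filter Topology

variable {E : Type*} [NormedAddCommGroup E] [InnerProductSpace ℝ E]

/-- A convex set lies on one side of the hyperplane spanned by an extreme subset which is a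
neighbourhood of `0` in that hyperplane. -/
lemma IsExtreme.inner_nonneg_or_nonpos {P F : Set E} (hP : Convex ℝ P) (hF : IsExtreme ℝ P F)
    {u : E} (hFu : ∀ y ∈ F, ⟪u, y⟫ = 0) {ε : ℝ} (hε : 0 < ε)
    (hball : ∀ y : E, ⟪u, y⟫ = 0 → ‖y‖ < ε → y ∈ F) :
    (∀ y ∈ P, 0 ≤ ⟪u, y⟫) ∨ (∀ y ∈ P, ⟪u, y⟫ ≤ 0) := by
  by_contra! h
  obtain ⟨⟨q, hq, hq'⟩, p, hp, hp'⟩ := h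
  set a := ⟪u, p⟫ with ha
  set b := ⟪u, q⟫ with hb
  have hab : 0 < a - b := by linarith
  set r := (-b / (a - b)) • p + (a / (a - b)) • q with hr
  have hc1 : 0 < -b / (a - b) := div_pos (by linarith) hab
  have hc2 : 0 < a / (a - b) := div_pos hp' hab
  have hc3 : -b / (a - b) + a / (a - b) = 1 := by field_simp; ring
  have hrP : r ∈ P := hP hp hq hc1.le hc2.le hc3
  have hru : ⟪u, r⟫ = 0 := by
    simp only [hr, inner_add_right, inner_smul_right, ← ha, ← hb]
    ring
  have h0F : (0 : E) ∈ F := hball 0 (by simp) (by simpa using hε)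
  have hrF : r ∈ F := by
    set δ := ε / (2 * (‖r‖ + 1)) with hδ
    have hδ0 : 0 < δ := by positivity
    have hneg : -(δ • r) ∈ F := by
      refine hball _ (by simp [inner_smul_right, hru]) ?_
      rw [norm_neg, norm_smul, Real.norm_of_nonneg hδ0.le, hδ, div_mul_eq_mul_div,
        div_lt_iff₀ (by positivity)]
      nlinarith [norm_nonneg r]
    refine hF.left_mem_of_mem_openSegment hrP (hF.subset hneg) h0F
      ⟨δ / (1 + δ), 1 / (1 + δ), by positivity, by positivity, by field_simp; ring, ?_⟩
    rw [smul_neg, smul_smul, ← sub_eq_add_neg, ← sub_smul, div_mul_eq_mul_div, one_mul, sub_self,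
      zero_smul]
  have hpF : p ∈ F := hF.left_mem_of_mem_openSegment hp hq hrF ⟨_, _, hc1, hc2, hc3, rfl⟩
  exact hp'.ne' (hFu p hpF)

lemma exists_ball_subset_of_zero_mem_intrinsicInterior {F : Set E}
    (h0 : (0 : E) ∈ intrinsicInterior ℝ F) :
    ∃ ε > 0, ∀ y ∈ (affineSpan ℝ F).direction, ‖y‖ < ε → y ∈ F := by
  obtain ⟨z, hz, hz0⟩ := mem_intrinsicInterior.1 h0
  obtain ⟨ε, hε, hb⟩ := Metric.mem_nhds_iff.1 (mem_interior_iff_mem_nhds.1 hz)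
  refine ⟨ε, hε, fun y hy hyε => ?_⟩
  have hy' : y ∈ affineSpan ℝ F := by
    simpa [hz0] using AffineSubspace.vadd_mem_of_mem_direction hy z.2
  have : (⟨y, hy'⟩ : affineSpan ℝ F) ∈ Metric.ball z ε := by
    simpa [Subtype.dist_eq, hz0] using hyε
  exact hb this

lemma exists_unit_normal [FiniteDimensional ℝ E] {D : Submodule ℝ E}
    (hD : Module.finrank ℝ D + 1 = Module.finrank ℝ E) :
    ∃ u : E, ‖u‖ = 1 ∧ (ℝ ∙ u)ᗮ = D := by
  have h1 : Module.finrank ℝ Dᗮ = 1 := Submodule.finrank_add_finrank_orthogonal' hD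
  have : Nontrivial Dᗮ := Module.nontrivial_of_finrank_pos (R := ℝ) (by omega)
  obtain ⟨v, hv⟩ := exists_norm_eq Dᗮ zero_le_one
  have hv0 : (v : E) ≠ 0 := by
    rw [← norm_ne_zero_iff, ← Submodule.coe_norm, hv]
    exact one_ne_zero
  refine ⟨v, hv, ?_⟩
  have : (ℝ ∙ (v : E)) = Dᗮ := Submodule.eq_of_le_of_finrank_eq
    ((Submodule.span_singleton_le_iff_mem _ _).2 v.2) (by rw [finrank_span_singleton hv0, h1])
  rw [this, Submodule.orthogonal_orthogonal]

end Facets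

section Discontinuity

open Set Filter Topology
open scoped NNReal ENNReal

/-- If `P` lies on one side of `u^⊥` and meets it in a neighbourhood of `0`, then the sections
by nearby hyperplanes see only about half of `P ∩ u^⊥`. -/
lemma not_continuousOn_radialFn {d : ℕ} (hd : 2 ≤ d) {P : Set (EuclideanSpace ℝ (Fin d))}
    (hP : IsCompact P) {u : EuclideanSpace ℝ (Fin d)} (hu : ‖u‖ = 1)
    (hpos : ∀ y ∈ P, 0 ≤ ⟪u, y⟫) {ε : ℝ} (hε : 0 < ε)
    (hball : ∀ y, ⟪u, y⟫ = 0 → ‖y‖ < ε → y ∈ P) :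
    ¬ ContinuousOn (radialFn ((d : ℝ) - 1) P) {x | x ≠ 0} := by
  intro hcont
  have hu0 : u ≠ 0 := by
    rw [← norm_ne_zero_iff, hu]
    exact one_ne_zero
  have hfin : Module.finrank ℝ (ℝ ∙ u)ᗮ = d - 1 := by
    refine Submodule.finrank_add_finrank_orthogonal' ?_
    rw [finrank_span_singleton hu0, finrank_euclideanSpace_fin]
    omega
  have hs : ((Module.finrank ℝ (ℝ ∙ u)ᗮ : ℕ) : ℝ) = (d : ℝ) - 1 := by
    rw [hfin]
    push_cast [show 1 ≤ d by omega]
    ring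
  have : Nontrivial (ℝ ∙ u)ᗮ := Module.nontrivial_of_finrank_pos (R := ℝ) (by omega)
  obtain ⟨⟨w, hwmem⟩, hw⟩ := exists_norm_eq (ℝ ∙ u)ᗮ zero_le_one
  replace hw : ‖w‖ = 1 := hw
  have huw : ⟪u, w⟫ = 0 := Submodule.mem_orthogonal_singleton_iff_inner_right.1 hwmem
  have hw0 : w ≠ 0 := by
    rw [← norm_ne_zero_iff, hw]
    exact one_ne_zero
  set s : ℝ := (d : ℝ) - 1 with hsdef
  have hs0 : 0 ≤ s := hs ▸ Nat.cast_nonneg _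
  let μ : Measure (ℝ ∙ u)ᗮ := μH[s]
  have hHaar : μ.IsAddHaarMeasure := by
    simp only [μ, ← hs]
    infer_instance
  set A : ℝ → Set (ℝ ∙ u)ᗮ := fun t => tilt u w t ⁻¹' P with hA
  have hAcpt : ∀ t, μ (A t) < ∞ := fun t => by
    obtain ⟨R, hR⟩ := hP.isBounded.subset_closedBall 0
    refine (measure_mono fun h hh => ?_).trans_lt
      (isCompact_closedBall (0 : (ℝ ∙ u)ᗮ) R).measure_lt_top
    have := hR hh
    rw [mem_closedBall_zero_iff] at this ⊢
    exact (norm_le_norm_tilt u w t h).trans this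
  have hA0 : 0 < μ (A 0) := by
    refine (Metric.measure_ball_pos μ 0 hε).trans_le (measure_mono fun h hh => ?_)
    have : (h : EuclideanSpace ℝ (Fin d)) ∈ P :=
      hball _ (inner_coe_orthogonal_singleton u h) (by simpa using hh)
    simpa [hA, tilt] using this
  have hupper : ∀ t, μH[s] (P ∩ perp (u - t • w)) ≤ ((1 + ‖t‖₊ : ℝ≥0) : ℝ≥0∞) ^ s * μ (A t) :=
    hausdorffMeasure_section_le hu hw huw hs0 P
  have hnorm : ∀ t : ℝ, 1 ≤ ‖u - t • w‖ := fun t => by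
    have key : ⟪u, t • w⟫ = 0 := by rw [inner_smul_right, huw, mul_zero]
    have := norm_sub_sq_eq_norm_sq_add_norm_sq_real key
    rw [hu] at this
    nlinarith [norm_nonneg (u - t • w), mul_self_nonneg ‖t • w‖]
  have hradial : ∀ t, radialFn s P (u - t • w) ≤ (1 + ‖t‖) ^ s * (μ (A t)).toReal := fun t => by
    refine (div_le_self ENNReal.toReal_nonneg (hnorm t)).trans ?_
    have hne : ((1 + ‖t‖₊ : ℝ≥0) : ℝ≥0∞) ^ s * μ (A t) ≠ ∞ :=
      ENNReal.mul_ne_top (ENNReal.rpow_ne_top_of_nonneg hs0 ENNReal.coe_ne_top) (hAcpt t).ne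
    have := ENNReal.toReal_mono hne (hupper t)
    rwa [ENNReal.toReal_mul, ← ENNReal.toReal_rpow, ENNReal.coe_toReal] at this
  have hradial0 : (μ (A 0)).toReal ≤ radialFn s P u := by
    rw [radialFn, hu, div_one]
    refine ENNReal.toReal_mono ?_ (hausdorffMeasure_tilt_zero_le u w hs0 P)
    have := hupper 0
    simp only [zero_smul, sub_zero] at this
    exact (this.trans_lt (ENNReal.mul_lt_top (by simp) (hAcpt 0))).ne
  set C : ℝ → ℝ := fun t => (μ (A t ∪ A (-t) ∪ A 0)).toReal with hC
  have hCfin : ∀ t, μ (A t ∪ A (-t) ∪ A 0) ≠ ∞ := fun t =>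
    (measure_union_lt_top (measure_union_lt_top (hAcpt _) (hAcpt _)) (hAcpt _)).ne
  have hsum : ∀ t ≠ 0, radialFn s P (u - t • w) + radialFn s P (u - (-t) • w) ≤
      (1 + ‖t‖) ^ s * C t := fun t ht => by
    have h1 := hradial t
    have h2 := hradial (-t)
    rw [norm_neg] at h2
    have h3 := ENNReal.toReal_mono (hCfin t)
      (measure_tilt_add_measure_tilt_neg_le hu hw0 huw hP.isClosed hpos μ ht)
    rw [ENNReal.toReal_add (hAcpt _).ne (hAcpt _).ne] at h3
    have h4 : 0 ≤ (1 + ‖t‖) ^ s := by positivity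
    have h5 := mul_le_mul_of_nonneg_left h3 h4
    rw [mul_add] at h5
    exact (add_le_add h1 h2).trans h5
  have hCtend : Tendsto (fun t => (1 + ‖t‖) ^ s * C t) (𝓝[≠] 0) (𝓝 (μ (A 0)).toReal) := by
    have h1 : Tendsto (fun t : ℝ => (1 + ‖t‖) ^ s) (𝓝[≠] 0) (𝓝 1) := by
      have : Continuous fun t : ℝ => (1 + ‖t‖) ^ s :=
        (continuous_const.add continuous_norm).rpow_const fun _ => Or.inr hs0
      simpa using (this.tendsto 0).mono_left nhdsWithin_le_nhds
    have h2 := (ENNReal.tendsto_toReal (hAcpt 0).ne).comp (tendsto_measure_tilt_union u w hP μ)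
    simpa using h1.mul h2
  have hat : ContinuousAt (radialFn s P) u := hcont.continuousAt (isOpen_ne.mem_nhds hu0)
  have hlim : ∀ c : ℝ, Tendsto (fun t : ℝ => radialFn s P (u - (c * t) • w)) (𝓝[≠] 0)
      (𝓝 (radialFn s P u)) := fun c => by
    have : Continuous fun t : ℝ => u - (c * t) • w := by fun_prop
    exact hat.tendsto.comp (by simpa using (this.tendsto 0).mono_left nhdsWithin_le_nhds)
  have hle := le_of_tendsto_of_tendsto ((hlim 1).add (hlim (-1))) hCtend
    (eventually_mem_nhdsWithin.mono fun t ht => by simpa using hsum t ht)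
  have := ENNReal.toReal_pos hA0.ne' (hAcpt 0).ne
  linarith

end Discontinuity

/-- Let `P ⊆ ℝ^d` (`d ≥ 2`) be a full-dimensional polytope such that the
origin lies in the relative interior of a facet `F` of `P` (a `(d-1)`-dimensional face).
Then the radial function `ρ_IP` is not continuous on `ℝ^d \ {0}`. -/
theorem statement_11 (d : ℕ) (hd : 2 ≤ d) (P : Set (EuclideanSpace ℝ (Fin d)))
    (hpoly : IsPolytope P) (hfull : (interior P).Nonempty)
    (F : Set (EuclideanSpace ℝ (Fin d)))
    (hFface : IsExtreme ℝ P F) (hFconv : Convex ℝ F)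
    (hFdim : Module.finrank ℝ (affineSpan ℝ F).direction = d - 1)
    (h0 : (0 : EuclideanSpace ℝ (Fin d)) ∈ intrinsicInterior ℝ F) :
    ¬ ContinuousOn (radialFn ((d : ℝ) - 1) P) {x | x ≠ 0} := by
  obtain ⟨S, rfl⟩ := hpoly
  have hcpt := S.finite_toSet.isCompact_convexHull ℝ
  obtain ⟨u, hu, hD⟩ := exists_unit_normal (D := (affineSpan ℝ F).direction) (by
    rw [hFdim, finrank_euclideanSpace_fin]
    omega)
  obtain ⟨ε, hε, hball⟩ := exists_ball_subset_of_zero_mem_intrinsicInterior h0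
  have hmem : ∀ y, y ∈ (affineSpan ℝ F).direction ↔ ⟪u, y⟫ = 0 := fun y => by
    rw [← hD, Submodule.mem_orthogonal_singleton_iff_inner_right]
  simp only [hmem] at hball
  have h0F : (0 : EuclideanSpace ℝ (Fin d)) ∈ F := intrinsicInterior_subset h0
  have hFu : ∀ y ∈ F, ⟪u, y⟫ = 0 := fun y hy => by
    rw [← hmem]
    simpa using AffineSubspace.vsub_mem_direction (subset_affineSpan ℝ F hy)
      (subset_affineSpan ℝ F h0F)
  rcases hFface.inner_nonneg_or_nonpos (convex_convexHull ℝ _) hFu hε hball with h | h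
  · exact not_continuousOn_radialFn hd hcpt hu h hε fun y hy hyε => hFface.subset (hball y hy hyε)
  · refine not_continuousOn_radialFn hd hcpt (u := -u) (by simpa using hu)
      (fun y hy => by simpa using h y hy) hε fun y hy hyε => hFface.subset (hball y ?_ hyε)
    simpa using hy
end
end

section
/- Let ρ : ℝ^d \ {0} → ℝ be a continuous positive function satisfying ρ(λx) = ρ(x)/λ for all λ > 0 and x ≠ 0, and let L := {0} ∪ {x ∈ ℝ^d \ {0} : ρ(x) ≥ 1} be the associated star body. Then L is strictly convex if and only if for all linearly independent x, y ∈ ℝ^d one has ρ(x)·ρ(y)/(ρ(x) + ρ(y)) < ρ(x + y). -/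
open MeasureTheory
open scoped RealInnerProductSpace

noncomputable section

/-- A set is strictly convex if it is convex and every point of the open segment between any
two of its distinct points lies in its interior. -/
def StrictlyConvexSet {d : ℕ} (L : Set (EuclideanSpace ℝ (Fin d))) : Prop :=
  Convex ℝ L ∧ ∀ p ∈ L, ∀ q ∈ L, p ≠ q → openSegment ℝ p q ⊆ interior L

/-- The gauge `1 / ρ` of the star body with radial function `ρ`, extended by `0` at the origin. -/
def radialGauge {E : Type*} [Zero E] (ρ : E → ℝ) (x : E) : ℝ :=
  open scoped Classical in if x = 0 then 0 else (ρ x)⁻¹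

section radialGauge

variable {E : Type*} [NormedAddCommGroup E] {ρ : E → ℝ}

@[simp] lemma radialGauge_zero : radialGauge ρ 0 = 0 := by simp [radialGauge]

lemma radialGauge_of_ne {x : E} (hx : x ≠ 0) : radialGauge ρ x = (ρ x)⁻¹ := by
  simp [radialGauge, hx]

lemma radialGauge_pos (hpos : ∀ x, x ≠ 0 → 0 < ρ x) {x : E} (hx : x ≠ 0) :
    0 < radialGauge ρ x := by
  rw [radialGauge_of_ne hx]
  exact inv_pos.2 (hpos x hx)

lemma mem_starBody_iff (hpos : ∀ x, x ≠ 0 → 0 < ρ x) (x : E) :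
    x ∈ ({0} ∪ {x | x ≠ 0 ∧ 1 ≤ ρ x} : Set E) ↔ radialGauge ρ x ≤ 1 := by
  by_cases hx : x = 0
  · simp [hx]
  · simp [radialGauge_of_ne hx, hx, inv_le_one₀ (hpos x hx)]

variable [NormedSpace ℝ E]

lemma radialGauge_smul (hhom : ∀ c : ℝ, 0 < c → ∀ x, x ≠ 0 → ρ (c • x) = ρ x / c)
    {c : ℝ} (hc : 0 ≤ c) (x : E) : radialGauge ρ (c • x) = c * radialGauge ρ x := by
  rcases hc.eq_or_lt with rfl | hc
  · simp
  by_cases hx : x = 0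
  · simp [hx]
  · rw [radialGauge_of_ne hx, radialGauge_of_ne (smul_ne_zero hc.ne' hx), hhom c hc x hx,
      inv_div, div_eq_mul_inv]

lemma starBody_mem_nhds_zero [ProperSpace E] (hcont : ContinuousOn ρ {x | x ≠ 0})
    (hpos : ∀ x, x ≠ 0 → 0 < ρ x)
    (hhom : ∀ c : ℝ, 0 < c → ∀ x, x ≠ 0 → ρ (c • x) = ρ x / c) :
    {x | radialGauge ρ x ≤ 1} ∈ nhds (0 : E) := by
  have hne : ∀ x ∈ Metric.sphere (0 : E) 1, x ≠ 0 := fun x hx ↦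
    ne_zero_of_mem_unit_sphere ⟨x, hx⟩
  obtain ⟨m, hm, hle⟩ := (isCompact_sphere (0 : E) 1).exists_forall_le' (hcont.mono hne)
    (a := 0) fun x hx ↦ hpos x (hne x hx)
  filter_upwards [Metric.ball_mem_nhds (0 : E) hm] with x hx
  by_cases h0 : x = 0
  · simp [h0]
  have hn : 0 < ‖x‖ := norm_pos_iff.2 h0
  have hu : ‖x‖⁻¹ • x ∈ Metric.sphere (0 : E) 1 := by
    simp [norm_smul, hn.ne']
  have h := hle _ hu
  rw [hhom _ (inv_pos.2 hn) x h0, div_inv_eq_mul] at h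
  rw [mem_ball_zero_iff] at hx
  have : 1 ≤ ρ x := by
    by_contra! hlt
    nlinarith
  rw [radialGauge_of_ne h0]
  exact inv_le_one_of_one_le₀ this

lemma mem_interior_starBody_iff [ProperSpace E] (hcont : ContinuousOn ρ {x | x ≠ 0})
    (hpos : ∀ x, x ≠ 0 → 0 < ρ x)
    (hhom : ∀ c : ℝ, 0 < c → ∀ x, x ≠ 0 → ρ (c • x) = ρ x / c) (x : E) :
    x ∈ interior {x | radialGauge ρ x ≤ 1} ↔ radialGauge ρ x < 1 := by
  rw [mem_interior_iff_mem_nhds]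
  by_cases hx : x = 0
  · subst hx
    simpa using starBody_mem_nhds_zero hcont hpos hhom
  constructor
  · intro h
    have ht : Filter.Tendsto (fun c : ℝ ↦ c • x) (nhdsWithin 1 (Set.Ioi 1)) (nhds x) := by
      have hc : Continuous fun c : ℝ ↦ c • x := by fun_prop
      simpa using (hc.tendsto 1).mono_left nhdsWithin_le_nhds
    obtain ⟨c, hcx, hc⟩ := ((ht.eventually h).and self_mem_nhdsWithin).exists
    have hc : 1 < c := hc
    rw [radialGauge_smul hhom (by linarith)] at hcx
    nlinarith [radialGauge_pos hpos hx]
  · intro h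
    have hnhds : {x : E | x ≠ 0} ∈ nhds x := isOpen_ne.mem_nhds hx
    rw [radialGauge_of_ne hx, inv_lt_one₀ (hpos x hx)] at h
    filter_upwards [hnhds, (hcont.continuousAt hnhds).eventually_const_lt h] with y hy hlt
    rw [radialGauge_of_ne hy]
    exact inv_le_one_of_one_le₀ hlt.le

lemma radialGauge_combo_lt_one_of_smul (hpos : ∀ x, x ≠ 0 → 0 < ρ x)
    (hhom : ∀ c : ℝ, 0 < c → ∀ x, x ≠ 0 → ρ (c • x) = ρ x / c)
    {p : E} {a b c : ℝ} (ha : 0 < a) (hb : 0 < b) (hab : a + b = 1) (hne : p ≠ c • p)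
    (hp : radialGauge ρ p ≤ 1) (hq : radialGauge ρ (c • p) ≤ 1) :
    radialGauge ρ (a • p + b • c • p) < 1 := by
  have hp0 : p ≠ 0 := by
    rintro rfl
    simp at hne
  have hgp := radialGauge_pos hpos hp0
  rw [smul_smul, ← add_smul]
  rcases le_or_gt 0 c with hc | hc
  · rw [radialGauge_smul hhom hc] at hq
    rw [radialGauge_smul hhom (by positivity)]
    have hc1 : c ≠ 1 := by
      rintro rfl
      simp at hne
    rcases hc1.lt_or_gt with h | h
    · nlinarith [mul_pos hb (sub_pos.2 h)]
    · nlinarith [mul_pos (mul_pos ha (sub_pos.2 h)) hgp]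
  · rcases le_or_gt 0 (a + b * c) with h | h
    · rw [radialGauge_smul hhom h]
      nlinarith [mul_pos hb (neg_pos.2 hc)]
    · have hd : (a + b * c) • p = ((a + b * c) / c) • c • p := by
        rw [smul_smul, div_mul_cancel₀ _ hc.ne]
      have hdc : (a + b * c) / c < 1 := by
        rw [div_lt_one_of_neg hc]
        nlinarith
      have hd0 : 0 ≤ (a + b * c) / c := (div_pos_of_neg_of_neg h hc).le
      rw [hd, radialGauge_smul hhom hd0]
      nlinarith

lemma radialGauge_add_lt_of_strictConvex [ProperSpace E] (hcont : ContinuousOn ρ {x | x ≠ 0})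
    (hpos : ∀ x, x ≠ 0 → 0 < ρ x)
    (hhom : ∀ c : ℝ, 0 < c → ∀ x, x ≠ 0 → ρ (c • x) = ρ x / c)
    (h : StrictConvex ℝ {x | radialGauge ρ x ≤ 1}) {x y : E}
    (hxy : LinearIndependent ℝ ![x, y]) :
    radialGauge ρ (x + y) < radialGauge ρ x + radialGauge ρ y := by
  have hgx := radialGauge_pos hpos (hxy.ne_zero 0)
  have hgy := radialGauge_pos hpos (hxy.ne_zero 1)
  simp only [Matrix.cons_val_zero, Matrix.cons_val_one] at hgx hgy
  set r := radialGauge ρ x with hr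
  set s := radialGauge ρ y with hs
  have hp : r⁻¹ • x ∈ {x | radialGauge ρ x ≤ 1} := by
    rw [Set.mem_ofPred_eq, radialGauge_smul hhom (by positivity), ← hr, inv_mul_cancel₀ hgx.ne']
  have hq : s⁻¹ • y ∈ {x | radialGauge ρ x ≤ 1} := by
    rw [Set.mem_ofPred_eq, radialGauge_smul hhom (by positivity), ← hs, inv_mul_cancel₀ hgy.ne']
  have hne : r⁻¹ • x ≠ s⁻¹ • y := by
    intro he
    have := (LinearIndependent.pair_iff.1 hxy r⁻¹ (-s⁻¹) (by rw [neg_smul, he, add_neg_cancel])).1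
    exact (inv_pos.2 hgx).ne' this
  have hint := h hp hq hne (a := r / (r + s)) (b := s / (r + s)) (by positivity) (by positivity)
    (by field_simp)
  have he : (r / (r + s)) • r⁻¹ • x + (s / (r + s)) • s⁻¹ • y = (r + s)⁻¹ • (x + y) := by
    rw [smul_smul, smul_smul, smul_add]
    congr 2 <;> field_simp
  rw [he, mem_interior_starBody_iff hcont hpos hhom, radialGauge_smul hhom (by positivity),
    inv_mul_lt_one₀ (by positivity)] at hint
  exact hint

lemma strictConvex_of_radialGauge_add_lt [ProperSpace E] (hcont : ContinuousOn ρ {x | x ≠ 0})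
    (hpos : ∀ x, x ≠ 0 → 0 < ρ x)
    (hhom : ∀ c : ℝ, 0 < c → ∀ x, x ≠ 0 → ρ (c • x) = ρ x / c)
    (h : ∀ x y : E, LinearIndependent ℝ ![x, y] →
      radialGauge ρ (x + y) < radialGauge ρ x + radialGauge ρ y) :
    StrictConvex ℝ {x | radialGauge ρ x ≤ 1} := by
  intro p hp q hq hne a b ha hb hab
  rw [mem_interior_starBody_iff hcont hpos hhom]
  rw [Set.mem_ofPred_eq] at hp hq
  by_cases hp0 : p = 0
  · subst hp0
    rw [smul_zero, zero_add, radialGauge_smul hhom hb.le]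
    nlinarith
  by_cases hli : LinearIndependent ℝ ![p, q]
  · have hli' : LinearIndependent ℝ ![a • p, b • q] := by
      rw [LinearIndependent.pair_iff] at hli ⊢
      intro s t hst
      simpa [ha.ne', hb.ne'] using hli (s * a) (t * b) (by rwa [mul_smul, mul_smul])
    have := h _ _ hli'
    rw [radialGauge_smul hhom ha.le, radialGauge_smul hhom hb.le] at this
    nlinarith
  · rw [LinearIndependent.pair_iff' hp0] at hli
    push Not at hli
    obtain ⟨c, rfl⟩ := hli
    exact radialGauge_combo_lt_one_of_smul hpos hhom ha hb hab hne hp hq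

end radialGauge

lemma strictlyConvexSet_iff_strictConvex {d : ℕ} {L : Set (EuclideanSpace ℝ (Fin d))} :
    StrictlyConvexSet L ↔ StrictConvex ℝ L := by
  rw [strictConvex_iff_openSegment_subset]
  refine ⟨fun h p hp q hq hne ↦ h.2 p hp q hq hne, fun h ↦ ⟨?_, fun p hp q hq hne ↦ h hp hq hne⟩⟩
  exact (strictConvex_iff_openSegment_subset.2 h).convex

/-- Let `ρ : ℝ^d \ {0} → ℝ` be continuous, positive, with
`ρ(λx) = ρ(x)/λ` for `λ > 0`, and `L = {0} ∪ {x ≠ 0 : ρ(x) ≥ 1}` the associated star body.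
Then `L` is strictly convex iff `ρ(x)ρ(y)/(ρ(x) + ρ(y)) < ρ(x + y)` for all linearly
independent `x, y`. -/
theorem statement_13 (d : ℕ) (ρ : EuclideanSpace ℝ (Fin d) → ℝ)
    (hcont : ContinuousOn ρ {x | x ≠ 0})
    (hpos : ∀ x : EuclideanSpace ℝ (Fin d), x ≠ 0 → 0 < ρ x)
    (hhom : ∀ lam : ℝ, 0 < lam → ∀ x : EuclideanSpace ℝ (Fin d), x ≠ 0 →
      ρ (lam • x) = ρ x / lam)
    (L : Set (EuclideanSpace ℝ (Fin d)))
    (hL : L = {0} ∪ {x | x ≠ 0 ∧ 1 ≤ ρ x}) :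
    StrictlyConvexSet L ↔ ∀ x y : EuclideanSpace ℝ (Fin d),
      LinearIndependent ℝ ![x, y] → ρ x * ρ y / (ρ x + ρ y) < ρ (x + y) := by
  have hset : L = {x | radialGauge ρ x ≤ 1} := by
    ext x
    rw [hL, mem_starBody_iff hpos, Set.mem_ofPred_eq]
  have key : ∀ x y : EuclideanSpace ℝ (Fin d), LinearIndependent ℝ ![x, y] →
      (ρ x * ρ y / (ρ x + ρ y) < ρ (x + y) ↔
        radialGauge ρ (x + y) < radialGauge ρ x + radialGauge ρ y) := by
    intro x y hxy
    have hx : x ≠ 0 := hxy.ne_zero 0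
    have hy : y ≠ 0 := hxy.ne_zero 1
    have hs : x + y ≠ 0 := fun h ↦
      one_ne_zero (LinearIndependent.pair_iff.1 hxy 1 1 (by simpa using h)).1
    have hρx := hpos x hx
    have hρy := hpos y hy
    rw [radialGauge_of_ne hx, radialGauge_of_ne hy, radialGauge_of_ne hs,
      inv_lt_comm₀ (hpos _ hs) (by positivity), inv_add_inv hρx.ne' hρy.ne', inv_div]
  rw [strictlyConvexSet_iff_strictConvex, hset]
  exact ⟨fun h x y hxy ↦ (key x y hxy).2
      (radialGauge_add_lt_of_strictConvex hcont hpos hhom h hxy),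
    fun h ↦ strictConvex_of_radialGauge_add_lt hcont hpos hhom
      fun x y hxy ↦ (key x y hxy).1 (h x y hxy)⟩
end
end

section
/- Let P ⊆ ℝ² be a polygon with the origin in its interior. Suppose that for every nonzero u ∈ ℝ² such that the line u^⊥ contains no vertex of P, the line u^⊥ intersects the boundary ∂P in the relative interiors of two edges of P that are parallel to each other. Then P = −P, i.e., P is centrally symmetric with center the origin. -/
open MeasureTheory
open scoped RealInnerProductSpace

noncomputable section

/-- The oriented area of the parallelogram spanned by two plane vectors. -/
def wedge (x y : EuclideanSpace ℝ (Fin 2)) : ℝ := x 0 * y 1 - x 1 * y 0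

/-- The quarter turn of a plane vector. -/
def quarterTurn (x : EuclideanSpace ℝ (Fin 2)) : EuclideanSpace ℝ (Fin 2) := !₂[-x 1, x 0]

lemma inner_quarterTurn (x y : EuclideanSpace ℝ (Fin 2)) :
    ⟪quarterTurn x, y⟫ = wedge x y := by
  simp [quarterTurn, wedge, PiLp.inner_apply, Fin.sum_univ_two]
  ring

lemma quarterTurn_ne_zero {x : EuclideanSpace ℝ (Fin 2)} (hx : x ≠ 0) : quarterTurn x ≠ 0 := by
  intro h
  apply hx
  have h0 := congrArg (fun v : EuclideanSpace ℝ (Fin 2) => v 0) h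
  have h1 := congrArg (fun v : EuclideanSpace ℝ (Fin 2) => v 1) h
  ext i
  fin_cases i <;> simp_all [quarterTurn]

lemma exists_smul_eq_of_wedge_eq_zero {x v : EuclideanSpace ℝ (Fin 2)} (hv : v ≠ 0)
    (h : wedge x v = 0) : ∃ c : ℝ, x = c • v := by
  unfold wedge at h
  by_cases h0 : v 0 = 0
  · have h1 : v 1 ≠ 0 := fun h1 => hv (by ext i; fin_cases i <;> simp [h0, h1])
    refine ⟨x 1 / v 1, ?_⟩
    ext i
    fin_cases i
    · simp_all
    · simp; field_simp
  · refine ⟨x 0 / v 0, ?_⟩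
    ext i
    fin_cases i
    · simp; field_simp
    · simp; field_simp; linarith

/-- If a line through the origin crosses two parallel segments at `α • x` and `-(β • x)`, then
the ratio `β / α` depends only on the segments. -/
lemma ratio_eq_of_mem_openSegment {a₁ b₁ a₂ b₂ x : EuclideanSpace ℝ (Fin 2)} {α β : ℝ}
    (hα : α ≠ 0) (h₁ : α • x ∈ openSegment ℝ a₁ b₁) (h₂ : -(β • x) ∈ openSegment ℝ a₂ b₂)
    (hab : a₁ ≠ b₁) (hx : wedge x a₁ ≠ 0)
    (hli : ¬ LinearIndependent ℝ ![b₁ - a₁, b₂ - a₂]) :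
    β / α = -wedge (b₁ - a₁) a₂ / wedge (b₁ - a₁) a₁ := by
  rw [LinearIndependent.pair_iff' (sub_ne_zero.2 hab.symm)] at hli
  push Not at hli
  obtain ⟨k, hk⟩ := hli
  obtain ⟨s, hs, hp₁⟩ := (openSegment_eq_image' ℝ a₁ b₁ ▸ h₁ :)
  obtain ⟨t, ht, hp₂⟩ := (openSegment_eq_image' ℝ a₂ b₂ ▸ h₂ :)
  simp only [← hk] at hp₂
  set d := b₁ - a₁
  have e₁ : ∀ i, a₁ i = α * x i - s * d i := fun i => by
    have := congrArg (fun v : EuclideanSpace ℝ (Fin 2) => v i) hp₁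
    simp at this; linarith
  have e₂ : ∀ i, a₂ i = -(β * x i) - t * (k * d i) := fun i => by
    have := congrArg (fun v : EuclideanSpace ℝ (Fin 2) => v i) hp₂
    simp at this; linarith
  have w₁ : wedge d a₁ = α * wedge d x := by
    simp only [wedge, e₁]; ring
  have w₂ : wedge d a₂ = -(β * wedge d x) := by
    simp only [wedge, e₂]; ring
  have hw : wedge d x ≠ 0 := by
    intro hw
    apply hx
    have : wedge x a₁ = s * wedge d x := by simp only [wedge, e₁]; ring
    rw [this, hw, mul_zero]
  rw [w₁, w₂]
  field_simp

lemma IsEdgeOf.left_mem_extremePoints {d : ℕ} {P : Set (EuclideanSpace ℝ (Fin d))}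
    {a b : EuclideanSpace ℝ (Fin d)} (h : IsEdgeOf P a b) : a ∈ P.extremePoints ℝ := by
  have ha : a ∈ (segment ℝ a b).extremePoints ℝ := by
    refine ⟨left_mem_segment ℝ a b, ?_⟩
    intro y hy z hz hayz
    rw [segment_eq_image'] at hy hz
    obtain ⟨s, hs, rfl⟩ := hy
    obtain ⟨t, ht, rfl⟩ := hz
    obtain ⟨p, q, hp, hq, hpq, e⟩ := hayz
    have hz : (p * s + q * t) • (b - a) = 0 := by
      have : p • (a + s • (b - a)) + q • (a + t • (b - a))
          = (p + q) • a + (p * s + q * t) • (b - a) := by module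
      rwa [this, hpq, one_smul, add_eq_left] at e
    have hz' := (smul_eq_zero.1 hz).resolve_right (sub_ne_zero.2 h.1.symm)
    have hs0 : s = 0 := by
      have := mul_nonneg hp.le hs.1
      have := mul_nonneg hq.le ht.1
      exact (mul_eq_zero.1 (by linarith : p * s = 0)).resolve_left hp.ne'
    simp [hs0]
  exact h.2.extremePoints_subset_extremePoints ha

lemma IsEdgeOf.symm {d : ℕ} {P : Set (EuclideanSpace ℝ (Fin d))}
    {a b : EuclideanSpace ℝ (Fin d)} (h : IsEdgeOf P a b) : IsEdgeOf P b a :=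
  ⟨h.1.symm, segment_symm ℝ a b ▸ h.2⟩

lemma zero_notMem_extremePoints_of_mem_interior {P : Set (EuclideanSpace ℝ (Fin 2))}
    (h0 : (0 : EuclideanSpace ℝ (Fin 2)) ∈ interior P) :
    (0 : EuclideanSpace ℝ (Fin 2)) ∉ P.extremePoints ℝ := by
  intro h
  obtain ⟨ε, hε, hb⟩ := Metric.mem_nhds_iff.1 (mem_interior_iff_mem_nhds.1 h0)
  obtain ⟨x, hx⟩ := exists_ne (0 : EuclideanSpace ℝ (Fin 2))
  have hxn := norm_pos_iff.2 hx
  have hn : ‖(ε / (2 * ‖x‖)) • x‖ < ε := by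
    rw [norm_smul, Real.norm_of_nonneg (by positivity)]
    field_simp
    norm_num
  have h₁ : (ε / (2 * ‖x‖)) • x ∈ P := hb (by simpa using hn)
  have h₂ : -((ε / (2 * ‖x‖)) • x) ∈ P := hb (by simpa using hn)
  have := h.2 h₁ h₂ ⟨1 / 2, 1 / 2, by norm_num, by norm_num, by norm_num, by module⟩
  exact smul_ne_zero (by positivity) hx this

/-- A convex body is symmetric if the ratio of its gauges in opposite directions takes only
finitely many values. -/
lemma eq_neg_of_finite_gauge_ratio {P : Set (EuclideanSpace ℝ (Fin 2))} (hc : Convex ℝ P)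
    (hcl : IsClosed P) (hb : Bornology.IsBounded P)
    (h0 : P ∈ nhds (0 : EuclideanSpace ℝ (Fin 2)))
    (hfin : ((fun x => gauge P x / gauge P (-x)) '' {0}ᶜ).Finite) : P = -P := by
  have hpos : ∀ x : EuclideanSpace ℝ (Fin 2), x ≠ 0 → 0 < gauge P x := fun x hx =>
    (gauge_pos (absorbent_nhds_zero h0) (NormedSpace.isVonNBounded_of_isBounded ℝ hb)).2 hx
  have hg : Continuous (gauge P) := continuous_gauge hc h0
  have hconn : IsPreconnected ({0}ᶜ : Set (EuclideanSpace ℝ (Fin 2))) :=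
    (isConnected_compl_singleton_of_one_lt_rank (by
      rw [← Module.finrank_eq_rank]; simp) 0).isPreconnected
  have himg := hconn.image (fun x => gauge P x / gauge P (-x))
    (hg.continuousOn.div (hg.comp continuous_neg).continuousOn
      fun x hx => (hpos _ (neg_ne_zero.2 hx)).ne')
  have hsub : ((fun x => gauge P x / gauge P (-x)) '' {0}ᶜ).Subsingleton := by
    by_contra hnt
    exact himg.infinite_of_nontrivial (Set.not_subsingleton_iff.1 hnt) hfin
  have heq : ∀ x, gauge P x = gauge P (-x) := by
    intro x
    by_cases hx : x = 0
    · simp [hx]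
    have h₁ := hpos x hx
    have h₂ := hpos (-x) (neg_ne_zero.2 hx)
    have := hsub ⟨x, hx, rfl⟩ ⟨-x, neg_ne_zero.2 hx, rfl⟩
    simp only [neg_neg] at this
    rw [div_eq_div_iff h₂.ne' h₁.ne'] at this
    nlinarith
  have hmem : ∀ x, x ∈ P ↔ gauge P x ≤ 1 := fun x => by
    rw [gauge_le_one_iff_mem_closure hc h0, hcl.closure_eq]
  ext x
  rw [Set.mem_neg, hmem, hmem, heq]

/-- Let `P ⊆ ℝ²` be a polygon with the origin in its interior. If every
line `u^⊥` through the origin containing no vertex of `P` meets `∂P` in the relative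
interiors of two parallel edges, then `P = -P`. -/
theorem statement_15 (P : Set (EuclideanSpace ℝ (Fin 2)))
    (hpoly : IsPolytope P) (h0 : (0 : EuclideanSpace ℝ (Fin 2)) ∈ interior P)
    (h : ∀ u : EuclideanSpace ℝ (Fin 2), u ≠ 0 →
      (∀ v ∈ P.extremePoints ℝ, ⟪u, v⟫ ≠ 0) →
      ∃ a₁ b₁ a₂ b₂ p₁ p₂ : EuclideanSpace ℝ (Fin 2),
        IsEdgeOf P a₁ b₁ ∧ IsEdgeOf P a₂ b₂ ∧
        p₁ ∈ openSegment ℝ a₁ b₁ ∧ p₂ ∈ openSegment ℝ a₂ b₂ ∧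
        frontier P ∩ perp u = {p₁, p₂} ∧
        ¬ LinearIndependent ℝ ![b₁ - a₁, b₂ - a₂]) :
    P = -P := by
  obtain ⟨S, hS⟩ := hpoly
  have hc : Convex ℝ P := hS ▸ convex_convexHull ℝ _
  have hK : IsCompact P := hS ▸ S.finite_toSet.isCompact_convexHull ℝ
  have hE : (P.extremePoints ℝ).Finite :=
    S.finite_toSet.subset (hS ▸ extremePoints_convexHull_subset)
  have hn := mem_interior_iff_mem_nhds.1 h0
  refine eq_neg_of_finite_gauge_ratio hc hK.isClosed hK.isBounded hn ?_
  set E := P.extremePoints ℝ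
  set f := fun x => gauge P x / gauge P (-x)
  have hF := ((hE.prod (hE.prod hE)).image fun t =>
    -wedge (t.2.1 - t.1) t.2.2 / wedge (t.2.1 - t.1) t.1)
  refine (hF.union ((hE.image f).union (hE.image fun v => f (-v)))).subset ?_
  rintro _ ⟨x, hx, rfl⟩
  have hpos : ∀ x : EuclideanSpace ℝ (Fin 2), x ≠ 0 → 0 < gauge P x := fun x hx =>
    (gauge_pos (absorbent_nhds_zero hn)
      (NormedSpace.isVonNBounded_of_isBounded ℝ hK.isBounded)).2 hx
  have hα := hpos x hx
  have hβ := hpos (-x) (neg_ne_zero.2 hx)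
  by_cases hgen : ∀ v ∈ E, wedge x v ≠ 0
  · obtain ⟨a₁, b₁, a₂, b₂, p₁, p₂, he₁, he₂, hp₁, hp₂, hfr, hli⟩ :=
      h (quarterTurn x) (quarterTurn_ne_zero hx) fun v hv => by
        rw [inner_quarterTurn]; exact hgen v hv
    left
    have hf : f x = (gauge P (-x))⁻¹ / (gauge P x)⁻¹ := by
      simp only [f]; field_simp
    have m₁ : (gauge P x)⁻¹ • x ∈ ({p₁, p₂} : Set _) := by
      rw [← hfr]
      refine ⟨?_, ?_⟩
      · rw [← gauge_eq_one_iff_mem_frontier hc hn, gauge_smul_of_nonneg (by positivity)]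
        exact inv_mul_cancel₀ hα.ne'
      · simp only [perp, Set.mem_ofPred_eq, inner_quarterTurn, wedge, PiLp.smul_apply, smul_eq_mul]
        ring
    have m₂ : -((gauge P (-x))⁻¹ • x) ∈ ({p₁, p₂} : Set _) := by
      rw [← hfr]
      refine ⟨?_, ?_⟩
      · rw [← gauge_eq_one_iff_mem_frontier hc hn, ← smul_neg,
          gauge_smul_of_nonneg (by positivity)]
        exact inv_mul_cancel₀ hβ.ne'
      · simp only [perp, Set.mem_ofPred_eq, inner_quarterTurn, wedge, PiLp.smul_apply,
          PiLp.neg_apply, smul_eq_mul]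
        ring
    have hne : (gauge P x)⁻¹ • x ≠ -((gauge P (-x))⁻¹ • x) := by
      intro he
      have : ((gauge P x)⁻¹ + (gauge P (-x))⁻¹) • x = 0 := by
        rw [add_smul, he, neg_add_cancel]
      exact smul_ne_zero (by positivity) hx this
    have hinv : (gauge P x)⁻¹ ≠ 0 := by positivity
    rw [hf]
    rcases m₁ with m₁ | m₁ <;> rcases m₂ with m₂ | m₂
    · exact absurd (m₁.trans m₂.symm) hne
    · refine ⟨(a₁, b₁, a₂), ⟨he₁.left_mem_extremePoints, he₁.symm.left_mem_extremePoints,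
        he₂.left_mem_extremePoints⟩, ?_⟩
      exact (ratio_eq_of_mem_openSegment hinv (m₁ ▸ hp₁) (m₂ ▸ hp₂) he₁.1
        (hgen _ he₁.left_mem_extremePoints) hli).symm
    · refine ⟨(a₂, b₂, a₁), ⟨he₂.left_mem_extremePoints, he₂.symm.left_mem_extremePoints,
        he₁.left_mem_extremePoints⟩, ?_⟩
      exact (ratio_eq_of_mem_openSegment hinv (m₁ ▸ hp₂) (m₂ ▸ hp₁) he₂.1
        (hgen _ he₂.left_mem_extremePoints)
        (by rwa [LinearIndependent.pair_symm_iff])).symm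
    · exact absurd (m₁.trans m₂.symm) hne
  · push Not at hgen
    obtain ⟨v, hv, hxv⟩ := hgen
    have hv0 : v ≠ 0 := fun e => zero_notMem_extremePoints_of_mem_interior h0 (e ▸ hv)
    obtain ⟨c, rfl⟩ := exists_smul_eq_of_wedge_eq_zero hv0 hxv
    have hc0 : c ≠ 0 := fun e => hx (by simp [e])
    have hscale : ∀ r : ℝ, 0 < r → ∀ y, f (r • y) = f y := fun r hr y => by
      simp only [f]
      rw [← smul_neg, gauge_smul_of_nonneg hr.le, gauge_smul_of_nonneg hr.le, smul_eq_mul,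
        smul_eq_mul, mul_div_mul_left _ _ hr.ne']
    right
    rcases hc0.lt_or_gt with hneg | hp
    · right
      refine ⟨v, hv, ?_⟩
      simp only
      rw [← hscale (-c) (by linarith) (-v), smul_neg, neg_smul, neg_neg]
    · left
      exact ⟨v, hv, (hscale c hp v).symm⟩
end
end
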